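/- arXiv:1908.10034 — 9 statements merged into one kernel-verified Lean document; each statement's English description precedes it below -/
import Mathlib

section
/- If A is a finite right distributive centrally essential ring, then A is isomorphic to a finite direct product A₁ × ⋯ × Aₙ of rings, where each Aᵢ is a commutative uniserial finite ring. In particular, A is commutative. -/
/-- A ring `A` is *centrally essential* if for every nonzero `a ∈ A` there exist
nonzero central elements `c, d ∈ A` with `a * c = d`. -/
def IsCentrallyEssential (A : Type*) [Ring A] : Prop :=
  ∀ a : A, a ≠ 0 → ∃ c d : A, c ∈ Set.center A ∧ d ∈ Set.center A ∧
    c ≠ 0 ∧ d ≠ 0 ∧ a * c = d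

/-- A ring is *right distributive* if the lattice of its right ideals is distributive. -/
def IsRightDistributive (A : Type*) [Ring A] : Prop :=
  ∀ I J K : Submodule Aᵐᵒᵖ A, I ⊓ (J ⊔ K) = (I ⊓ J) ⊔ (I ⊓ K)

universe u

theorem exists_pos_isIdempotentElem_pow {M : Type*} [Monoid M] [Finite M] (x : M) :
    ∃ n : ℕ, 0 < n ∧ IsIdempotentElem (x ^ n) := by
  obtain ⟨i, j, hij, h⟩ := Finite.exists_ne_map_eq_of_infinite (fun n : ℕ => x ^ n)
  wlog hlt : i < j generalizing i j
  · exact this j i hij.symm h.symm (by omega)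
  obtain ⟨k, rfl⟩ := Nat.exists_eq_add_of_lt hlt
  have hper : ∀ t m : ℕ, i ≤ m → x ^ (m + t * (k + 1)) = x ^ m := by
    intro t m hm
    induction t with
    | zero => simp
    | succ t ih =>
      obtain ⟨l, rfl⟩ := Nat.exists_eq_add_of_le hm
      calc x ^ (i + l + (t + 1) * (k + 1)) = x ^ (i + k + 1) * x ^ (l + t * (k + 1)) := by
            rw [← pow_add]; congr 1; ring
        _ = x ^ i * x ^ (l + t * (k + 1)) := by rw [← h]
        _ = x ^ (i + l) := by rw [← pow_add, ← ih]; congr 1; ring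
  refine ⟨(i + 1) * (k + 1), by positivity, ?_⟩
  rw [IsIdempotentElem, ← pow_add]
  exact hper _ _ (by nlinarith)

/-- If `p` is nilpotent, commuting elements with nilpotent difference have a common
`p`-power power. -/
theorem exists_pow_prime_pow_eq_of_isNilpotent_sub {R : Type*} [CommRing R] {p : ℕ}
    (hp : p.Prime) (hpn : IsNilpotent (p : R)) {u v : R} (h : IsNilpotent (u - v)) :
    ∃ n : ℕ, u ^ p ^ n = v ^ p ^ n := by
  obtain ⟨m, hm⟩ := hpn
  obtain ⟨a, ha⟩ := h
  obtain ⟨r, hr⟩ := exists_add_pow_prime_pow_eq hp v (u - v) a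
  have h0 : (u - v) ^ p ^ a = 0 := pow_eq_zero_of_le (Nat.lt_pow_self hp.one_lt).le ha
  have hd : (p : R) ∣ u ^ p ^ a - v ^ p ^ a := by
    refine ⟨v * (u - v) * r, ?_⟩
    rw [add_sub_cancel, h0] at hr
    rw [hr]; ring
  have := dvd_sub_pow_of_dvd_sub hd m
  rw [pow_succ, hm, zero_mul, zero_dvd_iff, ← pow_mul, ← pow_mul, ← pow_add, sub_eq_zero] at this
  exact ⟨_, this⟩

open scoped IsMulCommutative in
theorem Commute.exists_pow_prime_pow_eq_of_isNilpotent_sub {R : Type*} [Ring R] {p : ℕ}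
    (hp : p.Prime) (hpn : IsNilpotent (p : R)) {u v : R} (huv : Commute u v)
    (h : IsNilpotent (u - v)) : ∃ n : ℕ, u ^ p ^ n = v ^ p ^ n := by
  have hcomm : ∀ x ∈ ({u, v} : Set R), ∀ y ∈ ({u, v} : Set R), x * y = y * x := by
    rintro x (rfl | rfl) y (rfl | rfl)
    exacts [rfl, huv, huv.symm, rfl]
  let S := Subring.closure ({u, v} : Set R)
  have : IsMulCommutative S := Subring.isMulCommutative_closure hcomm
  let u' : S := ⟨u, Subring.subset_closure (by simp)⟩
  let v' : S := ⟨v, Subring.subset_closure (by simp)⟩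
  obtain ⟨m, hm⟩ := hpn
  obtain ⟨a, ha⟩ := h
  obtain ⟨n, hn⟩ := _root_.exists_pow_prime_pow_eq_of_isNilpotent_sub (R := S) (u := u') (v := v')
    hp ⟨m, Subtype.ext (by simpa using hm)⟩ ⟨a, Subtype.ext (by simpa using ha)⟩
  exact ⟨n, congrArg Subtype.val hn⟩

theorem Commute.isNilpotent_sub_of_pow_prime_pow_eq {R : Type*} [Ring R] {p : ℕ}
    (hp : p.Prime) (hpn : IsNilpotent (p : R)) {u v : R} (huv : Commute u v) {n : ℕ}
    (h : u ^ p ^ n = v ^ p ^ n) : IsNilpotent (u - v) := by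
  obtain ⟨r, hr⟩ := (huv.symm.sub_right (Commute.refl v)).exists_add_pow_prime_pow_eq hp n
  rw [add_sub_cancel, h, add_assoc, left_eq_add] at hr
  have hnil : IsNilpotent ((u - v) ^ p ^ n) := by
    rw [eq_neg_of_add_eq_zero_left hr]
    rw [mul_assoc, mul_assoc]
    exact ((Nat.cast_commute p _).isNilpotent_mul_right hpn).neg
  exact (IsNilpotent.pow_iff_pos (pow_ne_zero _ hp.ne_zero)).1 hnil

theorem IsRightDistributive.exists_mul_eq {A : Type*} [Ring A] (h : IsRightDistributive A)
    (x y : A) : ∃ s t r : A, x * (1 - t) = y * s ∧ y * t = x * r := by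
  have hx : x ∈ Submodule.span Aᵐᵒᵖ {x} ⊓
      (Submodule.span Aᵐᵒᵖ {y} ⊔ Submodule.span Aᵐᵒᵖ {x - y}) := by
    refine ⟨Submodule.mem_span_singleton_self x, ?_⟩
    have := Submodule.add_mem_sup (Submodule.mem_span_singleton_self (R := Aᵐᵒᵖ) y)
      (Submodule.mem_span_singleton_self (R := Aᵐᵒᵖ) (x - y))
    rwa [add_sub_cancel] at this
  rw [h, Submodule.mem_sup] at hx
  obtain ⟨b, ⟨-, hb⟩, c, ⟨hc', hc⟩, hbc⟩ := hx
  obtain ⟨s, rfl⟩ := Submodule.mem_span_singleton.1 hb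
  obtain ⟨t, rfl⟩ := Submodule.mem_span_singleton.1 hc
  obtain ⟨r, hr⟩ := Submodule.mem_span_singleton.1 hc'
  simp only [MulOpposite.smul_eq_mul_unop] at hbc hr
  refine ⟨s.unop - t.unop, t.unop, t.unop - r.unop, ?_, ?_⟩
  · have : x * (1 - t.unop) - y * (s.unop - t.unop) = x - (y * s.unop + (x - y) * t.unop) := by
      noncomm_ring
    rw [← sub_eq_zero, this, hbc, sub_self]
  · rw [mul_sub, hr, sub_mul, sub_sub_cancel]

theorem exists_mul_eq_of_isUnit_or_isUnit_one_sub {A : Type*} [Ring A]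
    (hloc : ∀ a : A, IsUnit a ∨ IsUnit (1 - a))
    (hdist : ∀ x y : A, ∃ s t r : A, x * (1 - t) = y * s ∧ y * t = x * r) (x y : A) :
    (∃ z, x = y * z) ∨ ∃ z, y = x * z := by
  obtain ⟨s, t, r, h1, h2⟩ := hdist x y
  rcases hloc t with ⟨u, rfl⟩ | ⟨u, hu⟩
  · exact Or.inr ⟨r * ↑u⁻¹, by rw [← mul_assoc, ← h2, Units.mul_inv_cancel_right]⟩
  · rw [← hu] at h1
    exact Or.inl ⟨s * ↑u⁻¹, by rw [← mul_assoc, ← h1, Units.mul_inv_cancel_right]⟩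

theorem IsCentrallyEssential.mul_comm_of_isIdempotentElem {A : Type*} [Ring A]
    (h : IsCentrallyEssential A) {e : A} (he : IsIdempotentElem e) (a : A) : e * a = a * e := by
  have key : ∀ {e f : A}, IsIdempotentElem e → f * e = 0 → ∀ a, e * a * f = 0 := by
    intro e f he hfe a
    by_contra hne
    obtain ⟨c, d, hc, hd, -, hd0, hcd⟩ := h _ hne
    rw [Semigroup.mem_center_iff] at hc hd
    apply hd0
    calc d = e * (e * a * f * c) := by rw [← hcd, ← mul_assoc, ← mul_assoc, ← mul_assoc, he.eq]
      _ = e * a * f * c * e := by rw [hcd, hd]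
      _ = e * a * (f * e) * c := by rw [mul_assoc _ c e, ← hc e]; simp only [mul_assoc]
      _ = 0 := by rw [hfe]; simp
  have h1 := key he (f := 1 - e) (by rw [sub_mul, one_mul, he.eq, sub_self]) a
  have h2 := key he.one_sub (f := e) (by rw [mul_sub, mul_one, he.eq, sub_self]) a
  rw [mul_sub, mul_one, sub_eq_zero] at h1
  rw [sub_mul, one_mul, sub_mul, sub_eq_zero] at h2
  rw [h1, h2]

theorem IsCentrallyEssential.of_surjective {A B : Type*} [Ring A] [Ring B]
    (h : IsCentrallyEssential A) (f : A →+* B) (hf : Function.Surjective f) {g : A}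
    (hg : IsIdempotentElem g) (hker : ∀ a, f a = 0 ↔ a * g = 0) : IsCentrallyEssential B := by
  have hcen : ∀ c ∈ Set.center A, f c ∈ Set.center B := fun c hc => by
    rw [Semigroup.mem_center_iff] at hc ⊢
    intro b
    obtain ⟨a, rfl⟩ := hf b
    rw [← map_mul, hc, map_mul]
  have hg1 : f g = 1 := by
    have : f (1 - g) = 0 := (hker _).2 (by rw [sub_mul, one_mul, hg.eq, sub_self])
    rw [map_sub, map_one, sub_eq_zero] at this
    exact this.symm
  intro b hb
  obtain ⟨a, rfl⟩ := hf b
  obtain ⟨c, d, hc, hd, -, hd0, hcd⟩ := h (a * g) fun h0 => hb ((hker a).2 h0)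
  have hfd : f d ≠ 0 := by
    have : d * g = d := by
      rw [← hcd, mul_assoc, ← Semigroup.mem_center_iff.1 hc g, ← mul_assoc, mul_assoc a, hg.eq]
    rwa [Ne, hker, this]
  have hfcd : f a * f c = f d := by rw [← hcd, map_mul, map_mul, hg1, mul_one]
  refine ⟨f c, f d, hcen c hc, hcen d hd, fun h0 => hfd ?_, hfd, hfcd⟩
  rw [← hfcd, h0, mul_zero]

theorem IsCentrallyEssential.isNilpotent_mulLeft_sub_mulRight {A : Type*} [Ring A] [Finite A]
    (h : IsCentrallyEssential A) (θ : A) :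
    IsNilpotent (LinearMap.mulLeft ℤ θ - LinearMap.mulRight ℤ θ) := by
  set D : Module.End ℤ A := LinearMap.mulLeft ℤ θ - LinearMap.mulRight ℤ θ with hD
  have : Finite (Module.End ℤ A) := Finite.of_injective _ DFunLike.coe_injective
  obtain ⟨n, hn, hidem⟩ := exists_pos_isIdempotentElem_pow D
  refine ⟨n, LinearMap.ext fun y => ?_⟩
  by_contra hne
  rw [LinearMap.zero_apply] at hne
  obtain ⟨c, d, hc, hd, -, hd0, hcd⟩ := h _ hne
  rw [Semigroup.mem_center_iff] at hc hd
  have hDc : ∀ z, D z * c = D (z * c) := fun z => by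
    simp only [hD, LinearMap.sub_apply, LinearMap.mulLeft_apply, LinearMap.mulRight_apply, sub_mul,
      mul_assoc, hc θ]
  have hDkc : ∀ k z, (D ^ k) z * c = (D ^ k) (z * c) := fun k => by
    induction k with
    | zero => simp
    | succ k ih => intro z; rw [pow_succ, Module.End.mul_apply, ih, hDc, Module.End.mul_apply]
  have hDd : D d = 0 := by simp [hD, hd θ]
  obtain ⟨m, rfl⟩ := Nat.exists_eq_add_of_lt hn
  apply hd0
  rw [← hcd, ← hidem.eq, Module.End.mul_apply, hDkc, hcd, pow_succ, Module.End.mul_apply, hDd,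
    map_zero]

theorem IsCentrallyEssential.exists_pow_prime_pow_mem_center {A : Type*} [Ring A] [Finite A]
    (h : IsCentrallyEssential A) {p : ℕ} (hp : p.Prime) (hpn : IsNilpotent (p : A)) (θ : A) :
    ∃ n : ℕ, ∀ y, θ ^ p ^ n * y = y * θ ^ p ^ n := by
  have hpE : IsNilpotent (p : Module.End ℤ A) := by
    obtain ⟨m, hm⟩ := hpn
    refine ⟨m, LinearMap.ext fun y => ?_⟩
    rw [← Nat.cast_pow, Module.End.natCast_apply, nsmul_eq_mul, Nat.cast_pow, hm, zero_mul,
      LinearMap.zero_apply]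
  obtain ⟨n, hn⟩ :=
    (LinearMap.commute_mulLeft_right θ θ).exists_pow_prime_pow_eq_of_isNilpotent_sub
    hp hpE (h.isNilpotent_mulLeft_sub_mulRight θ)
  refine ⟨n, fun y => ?_⟩
  rw [LinearMap.pow_mulLeft, LinearMap.pow_mulRight] at hn
  exact LinearMap.congr_fun hn y

/-- Modulo nilpotent elements, every element is central. -/
theorem IsCentrallyEssential.exists_central_isNilpotent_sub {A : Type*} [Ring A] [Finite A]
    (h : IsCentrallyEssential A) {p : ℕ} (hp : p.Prime) (hpn : IsNilpotent (p : A)) (x : A) :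
    ∃ z ∈ Subring.center A, IsNilpotent (x - z) := by
  obtain ⟨N, hN⟩ := h.exists_pow_prime_pow_mem_center hp hpn x
  have hz : x ^ p ^ N ∈ Subring.center A := Subring.mem_center_iff.2 fun y => (hN y).symm
  obtain ⟨i, j, hij, hpow⟩ := Finite.exists_ne_map_eq_of_infinite (fun k : ℕ => x ^ p ^ (N * k))
  wlog hlt : i < j generalizing i j
  · exact this j i hij.symm hpow.symm (by omega)
  obtain ⟨k, rfl⟩ := Nat.exists_eq_add_of_lt hlt
  refine ⟨x ^ p ^ (N * (k + 1)), ?_, ?_⟩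
  · rw [mul_add, mul_one, add_comm, pow_add, pow_mul]
    exact pow_mem hz _
  · refine (Commute.self_pow x _).isNilpotent_sub_of_pow_prime_pow_eq hp hpn (n := N * i) ?_
    rw [← pow_mul, ← pow_add, ← mul_add, add_comm (k + 1) i]
    exact hpow

theorem exists_isNilpotent_generator {A : Type*} [Ring A] [Finite A]
    (hchain : ∀ x y : A, (∃ z, x = y * z) ∨ ∃ z, y = x * z) :
    ∃ a : A, IsNilpotent a ∧ ∀ b : A, IsNilpotent b → ∃ y, b = a * y := by
  obtain ⟨a, ha, hmax⟩ := Set.exists_max_image {a : A | IsNilpotent a}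
    (fun a => Nat.card (Set.range (a * ·))) (Set.toFinite _) ⟨0, IsNilpotent.zero⟩
  refine ⟨a, ha, fun b hb => ?_⟩
  rcases hchain b a with h | ⟨z, hz⟩
  · exact h
  · have hsub : Set.range (a * ·) ⊆ Set.range (b * ·) := by
      rintro _ ⟨y, rfl⟩
      exact ⟨z * y, by simp only [hz, mul_assoc]⟩
    have heq := Set.eq_of_subset_of_ncard_le hsub (hmax b hb) (Set.toFinite _)
    have hbm : b ∈ Set.range (b * ·) := ⟨1, mul_one b⟩
    rw [← heq] at hbm
    obtain ⟨y, hy⟩ := hbm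
    exact ⟨y, hy.symm⟩

theorem exists_prime_not_isUnit_natCast (A : Type*) [Ring A] [Nontrivial A] [Finite A] :
    ∃ p : ℕ, p.Prime ∧ ¬ IsUnit (p : A) := by
  by_contra! hcon
  have hunit : ∀ n : ℕ, n ≠ 0 → IsUnit (n : A) := by
    intro n
    induction n using Nat.recOnMul with
    | zero => simp
    | one => simp
    | prime p hp => exact fun _ => hcon p hp
    | mul a b iha ihb =>
      intro hab
      rw [Nat.cast_mul]
      exact (iha (left_ne_zero_of_mul hab)).mul (ihb (right_ne_zero_of_mul hab))
  have := hunit (Nat.card A) Nat.card_pos.ne'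
  have h0 : (Nat.card A : A) = 0 := by
    have := card_nsmul_eq_zero' (G := A) (x := 1)
    simpa using this
  rw [h0] at this
  exact not_isUnit_zero this

theorem IsCentrallyEssential.mul_comm_of_local {A : Type*} [Ring A] [Nontrivial A] [Finite A]
    (h : IsCentrallyEssential A) (hloc : ∀ a : A, IsUnit a ∨ IsNilpotent a)
    (hchain : ∀ x y : A, (∃ z, x = y * z) ∨ ∃ z, y = x * z) (x y : A) : x * y = y * x := by
  obtain ⟨p, hp, hpu⟩ := exists_prime_not_isUnit_natCast A
  have hpn := (hloc p).resolve_left hpu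
  obtain ⟨a, ⟨n, hn⟩, hgen⟩ := exists_isNilpotent_generator hchain
  have hstep : ∀ x : A, ∃ z ∈ Subring.center A, ∃ y, x = z + a * y := fun x => by
    obtain ⟨z, hz, hnil⟩ := h.exists_central_isNilpotent_sub hp hpn x
    obtain ⟨y, hy⟩ := hgen _ hnil
    exact ⟨z, hz, y, by rw [← hy, add_sub_cancel]⟩
  have htop : ∀ S : Subring A, Subring.center A ≤ S → a ∈ S → ∀ x, x ∈ S := by
    intro S hS ha x
    have hexp : ∀ (k : ℕ) (x : A), ∃ s ∈ S, ∃ y, x = s + a ^ k * y := by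
      intro k
      induction k with
      | zero => exact fun x => ⟨0, S.zero_mem, x, by simp⟩
      | succ k ih =>
        intro x
        obtain ⟨z, hz, y, rfl⟩ := hstep x
        obtain ⟨s, hs, y, rfl⟩ := ih y
        exact ⟨z + a * s, S.add_mem (hS hz) (S.mul_mem ha hs), y, by
          rw [mul_add, ← mul_assoc, ← pow_succ', add_assoc]⟩
    obtain ⟨s, hs, y, rfl⟩ := hexp n x
    rwa [hn, zero_mul, add_zero]
  have ha : a ∈ Subring.center A := Subring.mem_center_iff.2 fun b =>
    (Subring.mem_centralizer_iff.1 (htop (Subring.centralizer {a})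
      (Subring.center_le_centralizer _) (Subring.mem_centralizer_iff.2 (by simp)) b) a rfl).symm
  exact (Subring.mem_center_iff.1 (htop _ le_rfl ha y) x)

theorem isUnit_or_isNilpotent_of_isIdempotentElem {A : Type*} [Ring A] [Finite A]
    (h : ∀ e : A, IsIdempotentElem e → e = 0 ∨ e = 1) (a : A) : IsUnit a ∨ IsNilpotent a := by
  obtain ⟨n, hn, hidem⟩ := exists_pos_isIdempotentElem_pow a
  rcases h _ hidem with h0 | h1
  · exact Or.inr ⟨n, h0⟩
  · exact Or.inl (IsUnit.of_pow_eq_one h1 hn.ne')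

theorem IsCentrallyEssential.mul_comm_of_finite {A : Type*} [Ring A] [Finite A]
    (h : IsCentrallyEssential A)
    (hdist : ∀ x y : A, ∃ s t r : A, x * (1 - t) = y * s ∧ y * t = x * r) (x y : A) :
    x * y = y * x := by
  induction hn : Nat.card A using Nat.strong_induction_on generalizing A with
  | _ n ih =>
  cases subsingleton_or_nontrivial A
  · exact Subsingleton.elim _ _
  by_cases hid : ∀ e : A, IsIdempotentElem e → e = 0 ∨ e = 1
  · have hloc := isUnit_or_isNilpotent_of_isIdempotentElem hid
    exact h.mul_comm_of_local hloc (exists_mul_eq_of_isUnit_or_isUnit_one_sub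
      (fun a => (hloc a).imp_right IsNilpotent.isUnit_one_sub) hdist) x y
  · push Not at hid
    obtain ⟨e, he, he0, he1⟩ := hid
    have key : ∀ e : A, IsIdempotentElem e → e ≠ 0 → (x * y - y * x) * (1 - e) = 0 := by
      intro e he he0
      have hcomm := h.mul_comm_of_isIdempotentElem he
      have : (Ideal.span {e}).IsTwoSided := ⟨fun {a} b ha => by
        rw [Ideal.mem_span_singleton'] at ha ⊢
        obtain ⟨c, rfl⟩ := ha
        exact ⟨c * b, by rw [mul_assoc, ← hcomm, mul_assoc]⟩⟩
      let f := Ideal.Quotient.mk (Ideal.span {e})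
      have hf : Function.Surjective f := Ideal.Quotient.mk_surjective
      have hker : ∀ a, f a = 0 ↔ a * (1 - e) = 0 := fun a => by
        rw [Ideal.Quotient.eq_zero_iff_mem, Ideal.mem_span_singleton', mul_sub, mul_one,
          sub_eq_zero]
        constructor
        · rintro ⟨c, rfl⟩
          rw [mul_assoc, he.eq]
        · exact fun ha => ⟨a, ha.symm⟩
      have hfe : f e = 0 := Ideal.Quotient.eq_zero_iff_mem.2 (Ideal.mem_span_singleton_self e)
      have : Finite (A ⧸ Ideal.span {e}) := Finite.of_surjective f hf
      have hcard : Nat.card (A ⧸ Ideal.span {e}) < n := by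
        rw [← hn]
        refine (Nat.card_le_card_of_surjective f hf).lt_of_ne fun heq => he0 ?_
        have hbij := (Nat.bijective_iff_surjective_and_card f).2 ⟨hf, heq.symm⟩
        exact hbij.1 (hfe.trans (map_zero f).symm)
      have hdist' : ∀ x y : A ⧸ Ideal.span {e}, ∃ s t r, x * (1 - t) = y * s ∧ y * t = x * r := by
        intro x y
        obtain ⟨x, rfl⟩ := hf x
        obtain ⟨y, rfl⟩ := hf y
        obtain ⟨s, t, r, h1, h2⟩ := hdist x y
        exact ⟨f s, f t, f r, by simp only [← map_one f, ← map_sub, ← map_mul, h1],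
          by simp only [← map_mul, h2]⟩
      rw [← hker, map_sub, map_mul, map_mul, sub_eq_zero]
      exact ih _ hcard (h.of_surjective f hf he.one_sub hker) hdist' (f x) (f y) rfl
    have h1 := key e he he0
    have h2 := key (1 - e) he.one_sub (sub_ne_zero.2 (Ne.symm he1))
    rw [sub_sub_cancel] at h2
    rw [mul_sub, h2, mul_one, sub_zero, sub_eq_zero] at h1
    exact h1

theorem Ideal.le_total_of_exists_mul_eq {B : Type*} [CommRing B]
    (h : ∀ x y : B, (∃ z, x = y * z) ∨ ∃ z, y = x * z) (I J : Ideal B) : I ≤ J ∨ J ≤ I := by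
  by_contra! hcon
  obtain ⟨x, hxI, hxJ⟩ := SetLike.not_le_iff_exists.1 hcon.1
  obtain ⟨y, hyJ, hyI⟩ := SetLike.not_le_iff_exists.1 hcon.2
  rcases h x y with ⟨z, rfl⟩ | ⟨z, rfl⟩
  · exact hxJ (J.mul_mem_right z hyJ)
  · exact hyI (I.mul_mem_right z hxI)

/-- A finite commutative ring with distributive ideal lattice is a finite product of
uniserial rings. -/
theorem exists_ringEquiv_pi_uniserial {A : Type u} [CommRing A] [Finite A]
    (hdist : ∀ x y : A, ∃ s t r : A, x * (1 - t) = y * s ∧ y * t = x * r) :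
    ∃ (n : ℕ) (B : Fin n → Type u) (instB : ∀ i, CommRing (B i)),
      letI := instB
      (∀ i, Finite (B i)) ∧ (∀ i, ∀ I J : Ideal (B i), I ≤ J ∨ J ≤ I) ∧
        Nonempty (A ≃+* ∀ i, B i) := by
  have hsurj : ∀ P : PrimeSpectrum A,
      Function.Surjective (algebraMap A (Localization.AtPrime P.asIdeal)) := fun P =>
    IsArtinianRing.localization_surjective P.asIdeal.primeCompl _
  let σ := (Finite.equivFin (PrimeSpectrum A)).symm
  refine ⟨Nat.card (PrimeSpectrum A), fun i => Localization.AtPrime (σ i).asIdeal,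
    fun i => inferInstance, fun i => Finite.of_surjective _ (hsurj (σ i)), fun i => ?_,
    ⟨(PrimeSpectrum.toPiLocalizationEquiv A).toRingEquiv.trans
      (RingEquiv.piCongrLeft (fun P : PrimeSpectrum A => Localization.AtPrime P.asIdeal) σ).symm⟩⟩
  refine Ideal.le_total_of_exists_mul_eq (exists_mul_eq_of_isUnit_or_isUnit_one_sub
    IsLocalRing.isUnit_or_isUnit_one_sub_self fun x y => ?_)
  obtain ⟨x, rfl⟩ := hsurj _ x
  obtain ⟨y, rfl⟩ := hsurj _ y
  obtain ⟨s, t, r, h1, h2⟩ := hdist x y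
  exact ⟨algebraMap _ _ s, algebraMap _ _ t, algebraMap _ _ r,
    by rw [← map_one (algebraMap A _), ← map_sub, ← map_mul, h1, map_mul],
    by rw [← map_mul, h2, map_mul]⟩

/-- If `A` is a finite, right distributive, centrally essential ring, then `A` is
isomorphic to a finite direct product `A₁ × ⋯ × Aₙ` of rings, where each `Aᵢ` is a
commutative uniserial finite ring; in particular `A` is commutative. -/
theorem finite_rightDistributive_centrallyEssential {A : Type u} [Ring A] [Nontrivial A]
    [Finite A] (hdist : IsRightDistributive A) (hCE : IsCentrallyEssential A) :
    (∃ (n : ℕ) (B : Fin n → Type u) (instB : ∀ i, CommRing (B i)),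
      letI := instB
      (∀ i, Finite (B i)) ∧ (∀ i, ∀ I J : Ideal (B i), I ≤ J ∨ J ≤ I) ∧
        Nonempty (A ≃+* ∀ i, B i)) ∧
    ∀ x y : A, x * y = y * x := by
  have hcomm := hCE.mul_comm_of_finite hdist.exists_mul_eq
  let : CommRing A := { ‹Ring A› with mul_comm := hcomm }
  exact ⟨exists_ringEquiv_pi_uniserial hdist.exists_mul_eq, hcomm⟩
end

section
/- Every finite right uniserial centrally essential ring is commutative. -/
/-- A ring is *right uniserial* if its right ideals are totally ordered by inclusion. -/
def IsRightUniserial (A : Type*) [Ring A] : Prop :=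
  ∀ I J : Submodule Aᵐᵒᵖ A, I ≤ J ∨ J ≤ I

section

variable {A : Type*} [Ring A]

theorem IsRightUniserial.exists_mul_eq_or (h : IsRightUniserial A) (x y : A) :
    (∃ r, y = x * r) ∨ ∃ r, x = y * r := by
  rcases h (Submodule.span Aᵐᵒᵖ {x}) (Submodule.span Aᵐᵒᵖ {y}) with hxy | hyx
  · obtain ⟨r, hr⟩ := Submodule.mem_span_singleton.1 (hxy (Submodule.mem_span_singleton_self x))
    exact Or.inr ⟨r.unop, hr.symm⟩
  · obtain ⟨r, hr⟩ := Submodule.mem_span_singleton.1 (hyx (Submodule.mem_span_singleton_self y))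
    exact Or.inl ⟨r.unop, hr.symm⟩

theorem isUnit_and_isUnit_of_isUnit_mul [Finite A] {x y : A} (h : IsUnit (x * y)) :
    IsUnit x ∧ IsUnit y := by
  obtain ⟨u, hu⟩ := h
  have h₁ : x * (y * ↑u⁻¹) = 1 := by rw [← mul_assoc, ← hu, Units.mul_inv]
  have h₂ : (↑u⁻¹ * x) * y = 1 := by rw [mul_assoc, ← hu, Units.inv_mul]
  exact ⟨IsUnit.of_mul_eq_one _ h₁, IsUnit.of_mul_eq_one_right _ h₂⟩

theorem IsRightUniserial.isUnit_or_isUnit_of_isUnit_add [Finite A] (h : IsRightUniserial A)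
    {x y : A} (hxy : IsUnit (x + y)) : IsUnit x ∨ IsUnit y := by
  rcases h.exists_mul_eq_or x y with ⟨r, rfl⟩ | ⟨r, rfl⟩
  · exact Or.inl (isUnit_and_isUnit_of_isUnit_mul (y := 1 + r) (by simpa [mul_add] using hxy)).1
  · exact Or.inr (isUnit_and_isUnit_of_isUnit_mul (y := r + 1) (by simpa [mul_add] using hxy)).1

/-- A finite right uniserial ring has a finite residue field. -/
theorem IsRightUniserial.exists_residueField.{u} {A : Type u} [Ring A] [Nontrivial A] [Finite A]
    (h : IsRightUniserial A) :
    ∃ (F : Type u) (_ : Field F) (_ : Finite F) (φ : A →+* F),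
      Function.Surjective φ ∧ ∀ x, φ x = 0 ↔ ¬ IsUnit x := by
  let J : Ideal A :=
    { carrier := {x | ¬ IsUnit x}
      zero_mem' := not_isUnit_zero
      add_mem' := fun hx hy hxy => (h.isUnit_or_isUnit_of_isUnit_add hxy).elim hx hy
      smul_mem' := fun _ _ hx hcx => hx (isUnit_and_isUnit_of_isUnit_mul hcx).2 }
  have mem_J (x : A) : x ∈ J ↔ ¬ IsUnit x := Iff.rfl
  have : J.IsTwoSided := ⟨fun _ ha hab => ha (isUnit_and_isUnit_of_isUnit_mul hab).1⟩
  have hmk (x : A) : Ideal.Quotient.mk J x = 0 ↔ ¬ IsUnit x := Ideal.Quotient.eq_zero_iff_mem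
  have : Nontrivial (A ⧸ J) := ⟨1, 0, by
    rw [← map_one (Ideal.Quotient.mk J), Ne, hmk]
    exact not_not.2 isUnit_one⟩
  have : NoZeroDivisors (A ⧸ J) := ⟨fun {a b} => by
    obtain ⟨a, rfl⟩ := Ideal.Quotient.mk_surjective a
    obtain ⟨b, rfl⟩ := Ideal.Quotient.mk_surjective b
    rw [← map_mul, hmk, hmk, hmk]
    intro hab
    by_contra! hc
    exact hab (hc.1.mul hc.2)⟩
  have : IsDomain (A ⧸ J) := NoZeroDivisors.to_isDomain _
  have : Finite (A ⧸ J) := Finite.of_surjective _ Ideal.Quotient.mk_surjective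
  exact ⟨A ⧸ J, (Finite.isDomain_to_isField (A ⧸ J)).toField, this, Ideal.Quotient.mk J,
    Ideal.Quotient.mk_surjective, hmk⟩

/-- The nonunits of a finite right uniserial ring form a principal right ideal. -/
theorem IsRightUniserial.exists_generator [Nontrivial A] [Finite A] (h : IsRightUniserial A) :
    ∃ π : A, ¬ IsUnit π ∧ ∀ x : A, ¬ IsUnit x → ∃ r, x = π * r := by
  have : Nonempty {x : A // ¬ IsUnit x} := ⟨0, not_isUnit_zero⟩
  obtain ⟨⟨π, hπ⟩, hmax⟩ := Finite.exists_max
    fun x : {x : A // ¬ IsUnit x} => (Set.range (x.1 * ·)).ncard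
  refine ⟨π, hπ, fun x hx => ?_⟩
  rcases h.exists_mul_eq_or π x with hr | ⟨r, hr⟩
  · exact hr
  · have hsub : Set.range (π * ·) ⊆ Set.range (x * ·) := by
      rintro _ ⟨s, rfl⟩
      exact ⟨r * s, by simp [hr, mul_assoc]⟩
    have heq := Set.eq_of_subset_of_ncard_le hsub (hmax ⟨x, hx⟩) (Set.toFinite _)
    have hmem : x ∈ Set.range (π * ·) := heq ▸ ⟨1, mul_one x⟩
    obtain ⟨s, hs⟩ := hmem
    exact ⟨s, hs.symm⟩

variable {F : Type*} [Field F] {φ : A →+* F} {π : A}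

theorem exists_pow_eq_zero_of_map_eq_zero [Finite A] (hφ : ∀ x, φ x = 0 ↔ ¬ IsUnit x)
    (hπ : φ π = 0) : ∃ n, π ^ n = 0 := by
  obtain ⟨i, j, hij, heq⟩ : ∃ i j, i < j ∧ π ^ i = π ^ j := by
    obtain ⟨i, j, hne, heq⟩ := Finite.exists_ne_map_eq_of_infinite (π ^ · : ℕ → A)
    rcases hne.lt_or_gt with hlt | hlt
    · exact ⟨i, j, hlt, heq⟩
    · exact ⟨j, i, hlt, heq.symm⟩
  refine ⟨i, ?_⟩
  have hu : IsUnit (1 - π ^ (j - i)) := by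
    by_contra hu
    have := (hφ _).2 hu
    simp [hπ, (Nat.sub_pos_of_lt hij).ne'] at this
  refine hu.mul_left_eq_zero.1 ?_
  rw [mul_sub, mul_one, ← pow_add, Nat.add_sub_cancel' hij.le, heq, sub_self]

theorem exists_eq_pow_mul_unit (hgen : ∀ x : A, ¬ IsUnit x → ∃ r, x = π * r)
    {n : ℕ} (hn : π ^ n = 0) {x : A} (hx : x ≠ 0) : ∃ (k : ℕ) (u : A), IsUnit u ∧
      x = π ^ k * u := by
  by_contra! hc
  have key (k : ℕ) : ∃ y, x = π ^ k * y := by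
    induction k with
    | zero => exact ⟨x, by simp⟩
    | succ k ih =>
      obtain ⟨y, hy⟩ := ih
      obtain ⟨r, rfl⟩ := hgen y fun hu => hc k y hu hy
      exact ⟨r, by rw [hy, pow_succ, mul_assoc]⟩
  obtain ⟨y, hy⟩ := key n
  exact hx (by simpa [hn] using hy)

theorem mul_pow_eq_pow_mul_iterate {s : A → A} (hs : ∀ a, a * π = π * s a) (k : ℕ) (a : A) :
    a * π ^ k = π ^ k * s^[k] a := by
  induction k generalizing a with
  | zero => simp
  | succ k ih => rw [pow_succ', ← mul_assoc, hs, mul_assoc, ih, ← mul_assoc,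
      Function.iterate_succ_apply]

theorem map_iterate_eq_of_mem_center (hφ : ∀ x, φ x = 0 ↔ ¬ IsUnit x)
    {s : A → A} (hs : ∀ a, a * π = π * s a) {k : ℕ} {u : A} (hu : IsUnit u)
    (hc : π ^ k * u ∈ Set.center A) (hne : π ^ k * u ≠ 0) (a : A) : φ (s^[k] a) = φ a := by
  have h₁ : π ^ k * (s^[k] a * u - u * a) = 0 := by
    rw [mul_sub, ← mul_assoc, ← mul_assoc, ← mul_pow_eq_pow_mul_iterate hs, mul_assoc,
      (Set.mem_center_iff.1 hc).comm a, sub_self]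
  have h₂ : φ (s^[k] a * u - u * a) = 0 := by
    rw [hφ]
    intro hunit
    rw [hunit.mul_left_eq_zero.1 h₁, zero_mul] at hne
    exact hne rfl
  have hu₀ : φ u ≠ 0 := fun h => (hφ u).1 h hu
  rw [map_sub, map_mul, map_mul, sub_eq_zero, mul_comm (φ u)] at h₂
  exact mul_right_cancel₀ hu₀ h₂

/-- In a centrally essential ring, a generator of the maximal ideal commutes with every element
modulo the square of the maximal ideal. -/
theorem IsCentrallyEssential.exists_mul_generator_eq (hCE : IsCentrallyEssential A)
    (hφ : ∀ x, φ x = 0 ↔ ¬ IsUnit x)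
    (hπ : φ π = 0) (hπ₀ : π ≠ 0) (hgen : ∀ x : A, ¬ IsUnit x → ∃ r, x = π * r)
    {n : ℕ} (hn : π ^ n = 0) (a : A) : ∃ t, a * π = π * (a + π * t) := by
  have hex (a : A) : ∃ r, a * π = π * r := hgen _ ((hφ _).1 (by rw [map_mul, hπ, mul_zero]))
  choose s hs using hex
  obtain ⟨c, d, hc, hd, hc₀, hd₀, hcd⟩ := hCE π hπ₀
  obtain ⟨k, u, hu, rfl⟩ := exists_eq_pow_mul_unit hgen hn hc₀
  rw [← mul_assoc, ← pow_succ'] at hcd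
  subst hcd
  have h₁ := map_iterate_eq_of_mem_center hφ hs hu hc hc₀ (s a)
  have h₂ := map_iterate_eq_of_mem_center hφ hs hu hd hd₀ a
  rw [Function.iterate_succ_apply, h₁] at h₂
  obtain ⟨t, ht⟩ := hgen (s a - a) ((hφ _).1 (by rw [map_sub, h₂, sub_self]))
  exact ⟨t, by rw [hs, ← ht, add_sub_cancel]⟩

/-- The residue field has a system of representatives formed by `0` and the powers of a unit whose
order is invertible. -/
theorem exists_unit_pow_representatives [Finite A] [Finite F] (hφ : ∀ x, φ x = 0 ↔ ¬ IsUnit x)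
    (hsurj : Function.Surjective φ) :
    ∃ (a : Aˣ) (m : ℕ), a ^ m = 1 ∧ φ m ≠ 0 ∧ ∀ x, φ x ≠ 0 → ∃ i : ℕ, φ x = φ (a ^ i : Aˣ) := by
  obtain ⟨p, hp⟩ := CharP.exists F
  have hprime : Fact p.Prime := ⟨CharP.char_is_prime F p⟩
  obtain ⟨g, hg⟩ := IsCyclic.exists_generator (α := Fˣ)
  obtain ⟨b, hb⟩ := hsurj g
  obtain ⟨b, rfl⟩ : IsUnit b := by
    by_contra h
    exact g.ne_zero (hb ▸ (hφ b).2 h)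
  obtain ⟨e, m, hm, hord⟩ := Nat.exists_eq_pow_mul_and_not_dvd (orderOf_pos b).ne' p
    hprime.out.ne_one
  refine ⟨b ^ p ^ e, m, ?_, ?_, fun x hx => ?_⟩
  · rw [← pow_mul, ← hord, pow_orderOf_eq_one]
  · rwa [map_natCast, Ne, CharP.cast_eq_zero_iff F p]
  · obtain ⟨y, hy⟩ := (bijective_iterateFrobenius F p e).2 (φ x)
    rw [iterateFrobenius_def] at hy
    have hy₀ : y ≠ 0 := by
      rintro rfl
      exact hx (by rw [← hy, zero_pow (pow_ne_zero _ hprime.out.ne_zero)])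
    obtain ⟨i, hi⟩ := (mem_powers_iff_mem_zpowers).2 (hg (Units.mk0 y hy₀))
    refine ⟨i, ?_⟩
    have hi' : (g : F) ^ i = y := by simpa using congrArg Units.val hi
    rw [← hy, ← hi']
    simp only [Units.val_pow_eq_pow_val, map_pow, hb]
    rw [← pow_mul, ← pow_mul, mul_comm]

/-- Averaging over the conjugates by a unit whose order is invertible produces a generator of the
maximal ideal that commutes with this unit. -/
theorem exists_commuting_generator (hφ : ∀ x, φ x = 0 ↔ ¬ IsUnit x) (hπ : φ π = 0)
    (hcomm : ∀ a : A, ∃ t, a * π = π * (a + π * t))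
    {a : Aˣ} {m : ℕ} (ha : a ^ m = 1) (hm : φ m ≠ 0) :
    ∃ u : Aˣ, (a : A) * (π * u) = π * u * a := by
  choose t ht using hcomm
  have hconj (i : ℕ) : ((a ^ i : Aˣ) : A) * π * ((a ^ i)⁻¹ : Aˣ) =
      π * (1 + π * (t (a ^ i : Aˣ) * ((a ^ i)⁻¹ : Aˣ))) := by
    rw [ht, mul_assoc, add_mul, Units.mul_inv, mul_assoc]
  have hsum : ∑ i ∈ Finset.range m, ((a ^ i : Aˣ) : A) * π * ((a ^ i)⁻¹ : Aˣ) =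
      π * (m + π * ∑ i ∈ Finset.range m, t (a ^ i : Aˣ) * ((a ^ i)⁻¹ : Aˣ)) := by
    rw [Finset.sum_congr rfl fun i _ => hconj i, ← Finset.mul_sum, Finset.sum_add_distrib,
      ← Finset.mul_sum]
    simp
  obtain ⟨u, hu⟩ : IsUnit (m + π * ∑ i ∈ Finset.range m, t (a ^ i : Aˣ) * ((a ^ i)⁻¹ : Aˣ)) := by
    by_contra h
    have := (hφ _).2 h
    rw [map_add, map_mul, hπ, zero_mul, add_zero] at this
    exact hm this
  refine ⟨u, ?_⟩
  rw [← Units.mul_inv_eq_iff_eq_mul, hu, ← hsum, Finset.mul_sum, Finset.sum_mul]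
  have hshift (i : ℕ) : (a : A) * (((a ^ i : Aˣ) : A) * π * ((a ^ i)⁻¹ : Aˣ)) * (a⁻¹ : Aˣ) =
      ((a ^ (i + 1) : Aˣ) : A) * π * ((a ^ (i + 1))⁻¹ : Aˣ) := by
    simp [pow_succ', mul_assoc]
  rw [Finset.sum_congr rfl fun i _ => hshift i]
  have h := (Finset.sum_range_succ' (fun i => ((a ^ i : Aˣ) : A) * π * ((a ^ i)⁻¹ : Aˣ)) m).symm.trans
    (Finset.sum_range_succ _ m)
  simpa [ha] using h

/-- A unit whose powers represent the residue field, together with a generator of the maximal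
ideal, generates the ring. -/
theorem subring_eq_top_of_mem (hφ : ∀ x, φ x = 0 ↔ ¬ IsUnit x)
    (hgen : ∀ x : A, ¬ IsUnit x → ∃ r, x = π * r) {n : ℕ} (hn : π ^ n = 0) {a : Aˣ}
    (hrep : ∀ x, φ x ≠ 0 → ∃ i : ℕ, φ x = φ (a ^ i : Aˣ))
    (S : Subring A) (haS : (a : A) ∈ S) (hπS : π ∈ S) (x : A) : x ∈ S := by
  have step (x : A) : ∃ y ∈ S, ∃ z, x = y + π * z := by
    by_cases hx : φ x = 0
    · obtain ⟨r, hr⟩ := hgen x ((hφ x).1 hx)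
      exact ⟨0, S.zero_mem, r, by rw [hr, zero_add]⟩
    · obtain ⟨i, hi⟩ := hrep x hx
      obtain ⟨r, hr⟩ := hgen (x - (a ^ i : Aˣ)) ((hφ _).1 (by rw [map_sub, hi, sub_self]))
      exact ⟨(a ^ i : Aˣ), by simpa using S.pow_mem haS i, r, by rw [← hr, add_sub_cancel]⟩
  have key (k : ℕ) : ∃ y ∈ S, ∃ z, x = y + π ^ k * z := by
    induction k with
    | zero => exact ⟨0, S.zero_mem, x, by simp⟩
    | succ k ih =>
      obtain ⟨y, hy, z, hz⟩ := ih
      obtain ⟨y', hy', z', rfl⟩ := step z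
      exact ⟨y + π ^ k * y', S.add_mem hy (S.mul_mem (S.pow_mem hπS k) hy'), z', by
        rw [hz, pow_succ, mul_add, add_assoc, mul_assoc]⟩
  obtain ⟨y, hy, z, hz⟩ := key n
  simpa [hz, hn] using hy

end

/-- Every finite, right uniserial, centrally essential ring is commutative. -/
theorem finite_rightUniserial_centrallyEssential_comm {A : Type*} [Ring A]
    [Nontrivial A] [Finite A]
    (huni : IsRightUniserial A) (hCE : IsCentrallyEssential A) :
    ∀ x y : A, x * y = y * x := by
  obtain ⟨F, _, _, φ, hsurj, hφ⟩ := huni.exists_residueField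
  obtain ⟨π, hπu, hgen⟩ := huni.exists_generator
  have hπ : φ π = 0 := (hφ π).2 hπu
  by_cases hπ₀ : π = 0
  · have hinj : Function.Injective φ := (injective_iff_map_eq_zero φ).2 fun x hx => by
      obtain ⟨r, hr⟩ := hgen x ((hφ x).1 hx)
      rw [hr, hπ₀, zero_mul]
    exact fun x y => hinj (by rw [map_mul, map_mul, mul_comm])
  obtain ⟨n, hn⟩ := exists_pow_eq_zero_of_map_eq_zero hφ hπ
  obtain ⟨a, m, ha, hm, hrep⟩ := exists_unit_pow_representatives hφ hsurj
  obtain ⟨u, hu⟩ := exists_commuting_generator hφ hπ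
    (hCE.exists_mul_generator_eq hφ hπ hπ₀ hgen hn) ha hm
  have hgen' (x : A) (hx : ¬ IsUnit x) : ∃ r, x = π * u * r := by
    obtain ⟨r, hr⟩ := hgen x hx
    exact ⟨↑u⁻¹ * r, by rw [mul_assoc, Units.mul_inv_cancel_left, hr]⟩
  obtain ⟨n', hn'⟩ := exists_pow_eq_zero_of_map_eq_zero (π := π * u) hφ (by simp [hπ])
  have htop := subring_eq_top_of_mem hφ hgen' hn' hrep
  have hcent (x : A) : x ∈ Subring.centralizer {(a : A), π * u} :=
    htop _ (by simp [Subring.mem_centralizer_iff, hu]) (by simp [Subring.mem_centralizer_iff, hu]) x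
  simp only [Subring.mem_centralizer_iff, Set.mem_insert_iff, Set.mem_singleton_iff,
    forall_eq_or_imp, forall_eq] at hcent
  have hcenter : ∀ x : A, x ∈ Subring.center A :=
    htop _ (Subring.mem_center_iff.2 fun x => ((hcent x).1).symm)
      (Subring.mem_center_iff.2 fun x => ((hcent x).2).symm)
  exact fun x y => Subring.mem_center_iff.1 (hcenter y) x
end

section
/- Let Z₂ be the field with two elements and let Q₈ be the quaternion group of order 8. Then the group ring Z₂[Q₈] is a centrally essential ring that is not commutative. -/
namespace MonoidAlgebra

variable {R G : Type*} [CommRing R] [Group G]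

/-- An element is central as soon as its coefficient function is a class function. -/
lemma mem_center_of_coeff_mul_comm {x : MonoidAlgebra R G}
    (hx : ∀ g h : G, x.coeff (g * h) = x.coeff (h * g)) :
    x ∈ Set.center (MonoidAlgebra R G) := by
  rw [Semigroup.mem_center_iff]
  intro y
  induction y using MonoidAlgebra.induction_linear with
  | zero => simp
  | add y₁ y₂ h₁ h₂ => rw [add_mul, mul_add, h₁, h₂]
  | single h r =>
    ext g
    rw [coeff_mul_single_apply, coeff_single_mul_apply, hx, mul_comm]

/-- In characteristic two, if `z` is an involution and all commutators of the group lie in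
`{1, z}`, then the annihilator of `1 + z` is central. -/
lemma mem_center_of_mul_one_add_single_eq_zero [CharP R 2] {z : G} (hz : z * z = 1)
    (hcomm : ∀ g h : G, h * g = g * h ∨ h * g = g * h * z)
    {x : MonoidAlgebra R G} (hx : x * (1 + single z 1) = 0) :
    x ∈ Set.center (MonoidAlgebra R G) := by
  have hinv (g : G) : x.coeff (g * z) = x.coeff g := by
    have h := congrArg (fun y ↦ y.coeff g) hx
    simp only [mul_add, mul_one, coeff_add, Finsupp.add_apply, coeff_mul_single_apply,
      coeff_zero, Finsupp.zero_apply, inv_eq_of_mul_eq_one_left hz] at h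
    exact (CharTwo.add_eq_zero.mp h).symm
  refine mem_center_of_coeff_mul_comm fun g h ↦ ?_
  rcases hcomm g h with e | e <;> rw [e]
  exact (hinv _).symm

/-- In characteristic two, the group ring of a group whose commutators all lie in `{1, z}` for a
central involution `z` is centrally essential. -/
theorem isCentrallyEssential [CharP R 2] {z : G} (hz : z * z = 1) (hzc : ∀ g, Commute z g)
    (hcomm : ∀ g h : G, h * g = g * h ∨ h * g = g * h * z) :
    IsCentrallyEssential (MonoidAlgebra R G) := by
  intro x hx
  by_cases h : x * (1 + single z 1) = 0
  · have : Nontrivial (MonoidAlgebra R G) := ⟨x, 0, hx⟩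
    exact ⟨1, x, Set.one_mem_center, mem_center_of_mul_one_add_single_eq_zero hz hcomm h,
      one_ne_zero, hx, mul_one x⟩
  · refine ⟨1 + single z 1, x * (1 + single z 1), Set.add_mem_center Set.one_mem_center ?_,
      mem_center_of_mul_one_add_single_eq_zero hz hcomm ?_, right_ne_zero_of_mul h, h, rfl⟩
    · exact Semigroup.mem_center_iff.mpr fun y ↦
        (single_commute hzc (Commute.all 1) y).symm
    · have hsq : (1 + single z 1 : MonoidAlgebra R G) * (1 + single z 1) = 0 := by
        have htwo : (1 + 1 : R) = 0 := CharTwo.add_self_eq_zero 1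
        simp only [mul_add, add_mul, one_mul, mul_one, single_mul_single, hz, one_def]
        rw [add_comm (single z 1), add_add_add_comm, ← single_add, ← single_add, htwo]
        simp
      rw [mul_assoc, hsq, mul_zero]

end MonoidAlgebra

/-- The group ring `Z₂[Q₈]` of the quaternion group of order `8` over the field with two
elements is a centrally essential ring that is not commutative. -/
theorem groupRing_zmodTwo_quaternionGroup_centrallyEssential_not_comm :
    IsCentrallyEssential (MonoidAlgebra (ZMod 2) (QuaternionGroup 2)) ∧
      ¬∀ x y : MonoidAlgebra (ZMod 2) (QuaternionGroup 2), x * y = y * x := by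
  refine ⟨MonoidAlgebra.isCentrallyEssential (z := .a 2) (by decide)
    (by unfold Commute SemiconjBy; decide)
    (by decide), fun h ↦ ?_⟩
  have hne : (.a 1 * .xa 0 : QuaternionGroup 2) ≠ .xa 0 * .a 1 := by decide
  have hprod := h (.single (.a 1) 1) (.single (.xa 0) 1)
  rw [MonoidAlgebra.single_mul_single, MonoidAlgebra.single_mul_single,
    MonoidAlgebra.single_left_inj (by simp)] at hprod
  exact hne hprod
end

section
/- A semiprime centrally essential ring is commutative; conversely, every commutative ring is centrally essential, so a semiprime ring A is centrally essential if and only if A is commutative. -/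
/-- In a semiprime ring a central element with zero square is zero. -/
theorem eq_zero_of_mem_center_of_mul_self_eq_zero {A : Type*} [Ring A]
    (hsemiprime : ∀ a : A, (∀ x : A, a * x * a = 0) → a = 0)
    {d : A} (hd : d ∈ Set.center A) (h : d * d = 0) : d = 0 := by
  refine hsemiprime d fun x => ?_
  rw [((Set.mem_center_iff.1 hd).comm x).eq, mul_assoc, h, mul_zero]

/-- A central element that multiplies `a` into the center annihilates all commutators of `a`. -/
theorem commutator_mul_eq_zero_of_mul_mem_center {A : Type*} [Ring A] {a c : A}
    (hc : c ∈ Set.center A) (hac : a * c ∈ Set.center A) (y : A) :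
    (a * y - y * a) * c = 0 := by
  have h₁ : c * y = y * c := ((Set.mem_center_iff.1 hc).comm y).eq
  have h₂ : a * c * y = y * (a * c) := ((Set.mem_center_iff.1 hac).comm y).eq
  rw [sub_mul, mul_assoc, ← h₁, ← mul_assoc, h₂, mul_assoc, sub_self]

/-- A semiprime ring `A` is centrally essential if and only if `A` is commutative. -/
theorem semiprime_centrallyEssential_iff_comm {A : Type*} [Ring A] [Nontrivial A]
    (hsemiprime : ∀ a : A, (∀ x : A, a * x * a = 0) → a = 0) :
    IsCentrallyEssential A ↔ ∀ x y : A, x * y = y * x := by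
  constructor
  · intro hess a y
    by_contra hne
    obtain ⟨c, d, hc, hd, -, hd0, hcd⟩ := hess (a * y - y * a) (sub_ne_zero.2 hne)
    -- The elements `z` of the center with `a * z` central satisfy `d * z = 0`.
    have key : ∀ z ∈ Set.center A, a * z ∈ Set.center A → d * z = 0 := by
      intro z hz haz
      rw [← hcd, mul_assoc, ((Set.mem_center_iff.1 hc).comm z).eq, ← mul_assoc,
        commutator_mul_eq_zero_of_mul_mem_center hz haz, zero_mul]
    by_cases had : a * d = 0
    · exact hd0 (eq_zero_of_mem_center_of_mul_self_eq_zero hsemiprime hd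
        (key d hd (had ▸ Set.zero_mem_center)))
    · obtain ⟨e, f, he, hf, -, hf0, hef⟩ := hess (a * d) had
      have hde : d * e ∈ Set.center A := Set.mul_mem_center hd he
      have h0 : d * (d * e) = 0 := key _ hde (by rwa [← mul_assoc, hef])
      have hde0 : d * e = 0 := by
        refine eq_zero_of_mem_center_of_mul_self_eq_zero hsemiprime hde ?_
        rw [mul_assoc, ((Set.mem_center_iff.1 he).comm (d * e)).eq, ← mul_assoc, h0, zero_mul]
      exact hf0 (by rw [← hef, mul_assoc, hde0, mul_zero])
  · intro hcomm a ha
    have hcenter : ∀ x : A, x ∈ Set.center A := fun x =>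
      Semigroup.mem_center_iff.2 fun y => hcomm y x
    exact ⟨1, a, hcenter 1, hcenter a, one_ne_zero, ha, mul_one a⟩
end

section
/- A prime ring A is centrally essential if and only if A is a commutative integral domain. -/
/-- A nonzero central element of a prime ring is left regular. -/
theorem eq_zero_of_central_mul_eq_zero {A : Type*} [Ring A]
    (hprime : ∀ a b : A, (∀ x : A, a * x * b = 0) → a = 0 ∨ b = 0)
    {c y : A} (hc : c ∈ Set.center A) (hc0 : c ≠ 0) (h : c * y = 0) : y = 0 := by
  refine (hprime c y fun x => ?_).resolve_left hc0
  rw [(Set.mem_center_iff.mp hc).comm x, mul_assoc, h, mul_zero]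

/-- A prime ring `A` is centrally essential if and only if `A` is a commutative
integral domain. -/
theorem prime_centrallyEssential_iff_commDomain {A : Type*} [Ring A] [Nontrivial A]
    (hprime : ∀ a b : A, (∀ x : A, a * x * b = 0) → a = 0 ∨ b = 0) :
    IsCentrallyEssential A ↔
      ((∀ x y : A, x * y = y * x) ∧ ∀ x y : A, x * y = 0 → x = 0 ∨ y = 0) := by
  constructor
  · intro h
    have hcomm : ∀ x y : A, x * y = y * x := by
      intro a y
      by_cases ha : a = 0
      · simp [ha]
      obtain ⟨c, d, hc, hd, hc0, -, hacd⟩ := h a ha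
      have hcc : ∀ x, c * x = x * c := (Set.mem_center_iff.mp hc).comm
      have hdc : ∀ x, d * x = x * d := (Set.mem_center_iff.mp hd).comm
      refine sub_eq_zero.mp (eq_zero_of_central_mul_eq_zero hprime hc hc0 ?_)
      rw [mul_sub, ← mul_assoc, hcc a, hacd, hcc (y * a), mul_assoc, hacd, hdc, sub_self]
    refine ⟨hcomm, fun x y hxy => hprime x y fun z => ?_⟩
    rw [hcomm x z, mul_assoc, hxy, mul_zero]
  · rintro ⟨hcomm, -⟩ a ha
    have hcenter : ∀ x : A, x ∈ Set.center A := fun x =>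
      Semigroup.mem_center_iff.mpr fun y => hcomm y x
    exact ⟨1, a, hcenter 1, hcenter a, one_ne_zero, ha, mul_one a⟩
end

section
/- Let A be a prime, right distributive, right Noetherian, centrally essential ring. Then A is commutative and, regarded as a commutative ring, A is a Dedekind domain. Conversely, every commutative Dedekind domain is a prime, right distributive, right Noetherian, centrally essential ring. -/
/-- A ring is *uniserial* if its right ideals are totally ordered by inclusion and its
left ideals are totally ordered by inclusion. -/
def IsUniserialRing (A : Type*) [Ring A] : Prop :=
  (∀ I J : Submodule Aᵐᵒᵖ A, I ≤ J ∨ J ≤ I) ∧ (∀ I J : Ideal A, I ≤ J ∨ J ≤ I)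

/-- A ring is *Artinian* if it is both left and right Artinian. -/
def IsArtinianBothSides (A : Type*) [Ring A] : Prop :=
  IsArtinian A A ∧ IsArtinian Aᵐᵒᵖ A

/-- The commutative ring structure obtained from a ring whose multiplication is
commutative. -/
def Ring.commRingOfComm (A : Type*) [inst : Ring A] (h : ∀ x y : A, x * y = y * x) :
    CommRing A := { inst with mul_comm := h }

/-- A (possibly noncommutative) ring is a *commutative Dedekind domain* if its
multiplication is commutative and, regarded as a commutative ring, it is a Dedekind
domain. -/
def IsCommDedekindDomain (A : Type*) [Ring A] : Prop :=
  ∃ h : ∀ x y : A, x * y = y * x, @IsDedekindDomain A (Ring.commRingOfComm A h)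

/-- A ring which is either a uniserial Artinian centrally essential ring or a
commutative Dedekind domain. -/
def IsGoodFactor (R : Type*) [Ring R] : Prop :=
  (IsUniserialRing R ∧ IsArtinianBothSides R ∧ IsCentrallyEssential R) ∨
    IsCommDedekindDomain R

universe u

section RightIdeals

/-- In a commutative ring, right ideals are the same as ideals. -/
def rightIdealOrderIso (A : Type*) [CommRing A] : Submodule Aᵐᵒᵖ A ≃o Ideal A where
  toFun I :=
    { I.toAddSubmonoid with
      smul_mem' := fun c x hx => by
        simpa [mul_comm] using I.smul_mem (MulOpposite.op c) hx }
  invFun I :=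
    { I.toAddSubmonoid with
      smul_mem' := fun c _ hx => I.mul_mem_right c.unop hx }
  left_inv _ := rfl
  right_inv _ := rfl
  map_rel_iff' := Iff.rfl

theorem isRightDistributive_iff_forall_ideal {A : Type*} [CommRing A] :
    IsRightDistributive A ↔ ∀ I J K : Ideal A, I ⊓ (J ⊔ K) = (I ⊓ J) ⊔ (I ⊓ K) := by
  let e := rightIdealOrderIso A
  constructor
  · intro h I J K
    simpa using congrArg e (h (e.symm I) (e.symm J) (e.symm K))
  · intro h I J K
    apply e.injective
    simpa using h (e I) (e J) (e K)

theorem isNoetherian_mulOpposite_iff {A : Type*} [CommRing A] :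
    IsNoetherian Aᵐᵒᵖ A ↔ IsNoetherianRing A := by
  rw [isNoetherianRing_iff, isNoetherian_iff', isNoetherian_iff']
  exact ⟨fun _ => (rightIdealOrderIso A).symm.strictMono.wellFoundedGT,
    fun _ => (rightIdealOrderIso A).strictMono.wellFoundedGT⟩

end RightIdeals

section Commutativity

variable {A : Type*} [Ring A]

theorem eq_zero_of_mul_center_eq_zero
    (hp : ∀ a b : A, (∀ x : A, a * x * b = 0) → a = 0 ∨ b = 0)
    {z c : A} (hc : c ∈ Set.center A) (hc0 : c ≠ 0) (h : z * c = 0) : z = 0 := by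
  refine (hp z c fun x => ?_).resolve_right hc0
  rw [mul_assoc, ← (Set.mem_center_iff.1 hc).comm x, ← mul_assoc, h, zero_mul]

/-- A prime centrally essential ring is commutative. -/
theorem IsCentrallyEssential.mul_comm_of_prime (h : IsCentrallyEssential A)
    (hp : ∀ a b : A, (∀ x : A, a * x * b = 0) → a = 0 ∨ b = 0) (x y : A) :
    x * y = y * x := by
  obtain rfl | hx := eq_or_ne x 0
  · simp
  obtain ⟨c, d, hc, hd, hc0, -, rfl⟩ := h x hx
  have hcy : c * y = y * c := (Set.mem_center_iff.1 hc).comm y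
  have hxy : x * c * y = y * (x * c) := (Set.mem_center_iff.1 hd).comm y
  refine sub_eq_zero.1 (eq_zero_of_mul_center_eq_zero hp hc hc0 ?_)
  rw [sub_mul, mul_assoc x, ← hcy, ← mul_assoc, hxy, mul_assoc, sub_self]

end Commutativity

section Distributive

variable {A : Type*} [CommRing A]

theorem exists_dvd_mul_and_dvd_mul_one_sub
    (h : ∀ I J K : Ideal A, I ⊓ (J ⊔ K) = (I ⊓ J) ⊔ (I ⊓ K)) (a b : A) :
    ∃ t : A, a ∣ b * t ∧ b ∣ a * (1 - t) := by
  have ha : a ∈ Ideal.span {a} ⊓ (Ideal.span {b} ⊔ Ideal.span {a - b}) := by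
    refine ⟨Ideal.mem_span_singleton_self a, ?_⟩
    simpa using add_mem
      (Ideal.mem_sup_left (Ideal.mem_span_singleton_self b) :
        b ∈ Ideal.span {b} ⊔ Ideal.span {a - b})
      (Ideal.mem_sup_right (Ideal.mem_span_singleton_self (a - b)))
  rw [h] at ha
  obtain ⟨x, ⟨-, hxb⟩, y, ⟨hya, hyab⟩, hxy⟩ := Submodule.mem_sup.1 ha
  obtain ⟨u, rfl⟩ := Ideal.mem_span_singleton'.1 hxb
  obtain ⟨v, rfl⟩ := Ideal.mem_span_singleton'.1 hya
  obtain ⟨t, ht⟩ := Ideal.mem_span_singleton'.1 hyab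
  exact ⟨t, ⟨t - v, by linear_combination -ht⟩, ⟨u - t, by linear_combination -hxy - ht⟩⟩

/-- A local ring of a domain with distributive ideal lattice is a valuation ring. -/
theorem Localization.AtPrime.valuationRing_of_ideal_distributive [IsDomain A]
    (h : ∀ I J K : Ideal A, I ⊓ (J ⊔ K) = (I ⊓ J) ⊔ (I ⊓ K)) (P : Ideal A) [P.IsPrime] :
    ValuationRing (Localization.AtPrime P) := by
  rw [ValuationRing.iff_dvd_total]
  refine ⟨fun x y => ?_⟩
  obtain ⟨a, s, rfl⟩ := IsLocalization.exists_mk'_eq P.primeCompl x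
  obtain ⟨b, s', rfl⟩ := IsLocalization.exists_mk'_eq P.primeCompl y
  let f := algebraMap A (Localization.AtPrime P)
  have assoc (c : A) (r : P.primeCompl) :
      Associated (f c) (IsLocalization.mk' (Localization.AtPrime P) c r) := by
    obtain ⟨w, hw⟩ := IsLocalization.map_units (Localization.AtPrime P) r
    refine Associated.symm ⟨w, ?_⟩
    rw [hw, IsLocalization.mk'_spec]
  rw [← (assoc a s).dvd_iff_dvd_left, ← (assoc b s').dvd_iff_dvd_right,
    ← (assoc b s').dvd_iff_dvd_left, ← (assoc a s).dvd_iff_dvd_right]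
  obtain ⟨t, hab, hba⟩ := exists_dvd_mul_and_dvd_mul_one_sub h a b
  have hab' : f a ∣ f b * f t := by simpa using map_dvd f hab
  have hba' : f b ∣ f a * (1 - f t) := by simpa using map_dvd f hba
  exact (IsLocalRing.isUnit_or_isUnit_one_sub_self (f t)).imp
    (fun ht => ht.dvd_mul_right.1 hab') (fun ht => ht.dvd_mul_right.1 hba')

/-- A Noetherian domain with distributive ideal lattice is a Dedekind domain. -/
theorem isDedekindDomain_of_ideal_distributive [IsDomain A] [IsNoetherianRing A]
    (h : ∀ I J K : Ideal A, I ⊓ (J ⊔ K) = (I ⊓ J) ⊔ (I ⊓ K)) : IsDedekindDomain A := by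
  have : IsDedekindDomainDvr A :=
    { is_dvr_at_nonzero_prime := fun P hP _ => by
        have : IsNoetherianRing (Localization.AtPrime P) :=
          IsLocalization.isNoetherianRing P.primeCompl _ inferInstance
        exact ((IsDiscreteValuationRing.TFAE _
          (IsLocalization.AtPrime.not_isField A hP (Localization.AtPrime P))).out 0 1).2
          (Localization.AtPrime.valuationRing_of_ideal_distributive h P) }
  infer_instance

theorem IsDedekindDomain.ideal_inf_sup [IsDedekindDomain A] (I J K : Ideal A) :
    I ⊓ (J ⊔ K) = (I ⊓ J) ⊔ (I ⊓ K) := by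
  refine le_antisymm (Ideal.le_of_localization_maximal fun P _ => ?_) le_inf_sup
  simp only [IsLocalization.map_inf P.primeCompl, Ideal.map_sup]
  rcases (ValuationRing.le_total_ideal (A := Localization.AtPrime P)).total
    (J.map (algebraMap A (Localization.AtPrime P)))
    (K.map (algebraMap A (Localization.AtPrime P))) with h | h
  · rw [sup_eq_right.2 h]
    exact le_sup_right
  · rw [sup_eq_left.2 h]
    exact le_sup_left

end Distributive

theorem isDedekindDomain_of_prime_of_isRightDistributive {A : Type*} [CommRing A] [Nontrivial A]
    (hp : ∀ a b : A, (∀ x : A, a * x * b = 0) → a = 0 ∨ b = 0)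
    (hd : IsRightDistributive A) (hn : IsNoetherian Aᵐᵒᵖ A) : IsDedekindDomain A := by
  have : NoZeroDivisors A :=
    ⟨fun {a b} hab => hp a b fun x => by rw [mul_right_comm, hab, zero_mul]⟩
  have : IsDomain A := NoZeroDivisors.to_isDomain A
  have : IsNoetherianRing A := isNoetherian_mulOpposite_iff.1 hn
  exact isDedekindDomain_of_ideal_distributive (isRightDistributive_iff_forall_ideal.1 hd)

/-- A prime, right distributive, right Noetherian, centrally essential ring is
commutative and, regarded as a commutative ring, is a Dedekind domain; conversely, every
commutative Dedekind domain is a prime, right distributive, right Noetherian, centrally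
essential ring. -/
theorem prime_rightDistributive_rightNoetherian_centrallyEssential :
    (∀ (A : Type u) [Ring A] [Nontrivial A],
      (∀ a b : A, (∀ x : A, a * x * b = 0) → a = 0 ∨ b = 0) →
      IsRightDistributive A → IsNoetherian Aᵐᵒᵖ A → IsCentrallyEssential A →
      (∀ x y : A, x * y = y * x) ∧ IsCommDedekindDomain A) ∧
    (∀ (A : Type u) [CommRing A] [IsDomain A] [IsDedekindDomain A],
      (∀ a b : A, (∀ x : A, a * x * b = 0) → a = 0 ∨ b = 0) ∧
      IsRightDistributive A ∧ IsNoetherian Aᵐᵒᵖ A ∧ IsCentrallyEssential A) := by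
  refine ⟨fun A _ _ hp hd hn hc => ?_, fun A _ _ _ => ⟨fun a b h => ?_, ?_, ?_, fun a ha => ?_⟩⟩
  · have hcomm := hc.mul_comm_of_prime hp
    refine ⟨hcomm, hcomm, ?_⟩
    let _ := Ring.commRingOfComm A hcomm
    exact isDedekindDomain_of_prime_of_isRightDistributive hp hd hn
  · simpa using h 1
  · exact isRightDistributive_iff_forall_ideal.2 IsDedekindDomain.ideal_inf_sup
  · exact isNoetherian_mulOpposite_iff.2 inferInstance
  · exact ⟨1, a, Set.one_mem_center, by simp [Set.center_eq_univ], one_ne_zero, ha, mul_one a⟩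
end

section
/- A centrally essential ring A is a semiprime, right distributive ring if and only if A is commutative and every submodule of every flat A-module is a flat A-module. -/
universe u

/-- Over a ring `A` with commutative multiplication, every submodule of every flat
`A`-module is flat. -/
def FlatSubmodulesOfFlatAreFlat (A : Type u) [Ring A] (h : ∀ x y : A, x * y = y * x) :
    Prop :=
  letI : CommRing A := Ring.commRingOfComm A h
  ∀ (M : Type u) [AddCommGroup M] [Module A M],
    Module.Flat A M → ∀ N : Submodule A M, Module.Flat A N

/-- A semiprime centrally essential ring is commutative. -/
theorem IsCentrallyEssential.mul_comm_of_semiprime {A : Type*} [Ring A]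
    (hCE : IsCentrallyEssential A) (hsp : ∀ a : A, (∀ x : A, a * x * a = 0) → a = 0)
    (a b : A) : a * b = b * a := by
  have eq_zero_of_sq : ∀ c ∈ Set.center A, c * c = 0 → c = 0 := fun c hc h ↦
    hsp c fun x ↦ by rw [(hc.comm x).eq, mul_assoc, h, mul_zero]
  by_contra hab
  obtain ⟨c, d, hc, hd, -, hd0, hcd⟩ := hCE (a * b - b * a) (sub_ne_zero.mpr hab)
  have d_mul_eq_zero : ∀ e ∈ Set.center A, a * e ∈ Set.center A → d * e = 0 := by
    intro e he hae
    have : (a * b - b * a) * e = 0 := by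
      rw [sub_mul, mul_assoc, ← (he.comm b).eq, ← mul_assoc, (hae.comm b).eq, mul_assoc, sub_self]
    rw [← hcd, mul_assoc, (hc.comm e).eq, ← mul_assoc, this, zero_mul]
  have hda : d * a = 0 := by
    by_contra hda
    obtain ⟨e, f, he, hf, -, hf0, hef⟩ := hCE (d * a) hda
    have hde : d * e ∈ Set.center A := Set.mul_mem_center hd he
    have hade : a * (d * e) = f := by rw [← mul_assoc, ← (hd.comm a).eq, hef]
    have hdde : d * (d * e) = 0 := d_mul_eq_zero _ hde (hade ▸ hf)
    have hde0 : d * e = 0 := eq_zero_of_sq _ hde <| by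
      rw [mul_assoc, ← mul_assoc e, (he.comm d).eq, mul_assoc, ← mul_assoc, ← mul_assoc,
        mul_assoc d d e, hdde, zero_mul]
    exact hf0 (by rw [← hade, hde0, mul_zero])
  refine hd0 (eq_zero_of_sq d hd ?_)
  nth_rewrite 2 [← hcd]
  rw [← mul_assoc, mul_sub, ← mul_assoc, hda, ← mul_assoc, (hd.comm b).eq, mul_assoc b, hda]
  simp

/-- A commutative ring is distributive if and only if any two elements divide each other up to
complementary multipliers. -/
theorem isRightDistributive_iff_exists_dvd {R : Type*} [CommRing R] :
    IsRightDistributive R ↔ ∀ a b : R, ∃ e, b ∣ a * e ∧ a ∣ b * (1 - e) := by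
  constructor
  · intro h a b
    have mem_span : ∀ x y : R, x ∈ Submodule.span Rᵐᵒᵖ {y} ↔ y ∣ x := fun x y ↦ by
      rw [Submodule.mem_span_singleton]
      exact ⟨fun ⟨r, hr⟩ ↦ ⟨r.unop, hr.symm⟩, fun ⟨r, hr⟩ ↦ ⟨.op r, hr.symm⟩⟩
    have ha : a ∈ Submodule.span Rᵐᵒᵖ {a} ⊓
        (Submodule.span Rᵐᵒᵖ {b} ⊔ Submodule.span Rᵐᵒᵖ {a - b}) :=
      ⟨Submodule.mem_span_singleton_self a, Submodule.mem_sup.mpr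
        ⟨b, Submodule.mem_span_singleton_self b, a - b, Submodule.mem_span_singleton_self _,
          add_sub_cancel b a⟩⟩
    rw [h, Submodule.mem_sup] at ha
    obtain ⟨u, ⟨-, hbu⟩, v, ⟨hav, habv⟩, huv⟩ := ha
    obtain ⟨r, rfl⟩ := (mem_span _ _).mp hbu
    obtain ⟨s, hs⟩ := (mem_span _ _).mp hav
    obtain ⟨t, ht⟩ := (mem_span _ _).mp habv
    exact ⟨1 - t, ⟨r - t, by linear_combination -huv + ht⟩, ⟨t - s, by linear_combination ht - hs⟩⟩
  · intro h I J K
    refine le_antisymm ?_ le_inf_sup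
    rintro x ⟨hx, hJK⟩
    obtain ⟨j, hj, k, hk, rfl⟩ := Submodule.mem_sup.mp hJK
    obtain ⟨e, ⟨r, hr⟩, ⟨s, hs⟩⟩ := h j k
    have mul_mem : ∀ (L : Submodule Rᵐᵒᵖ R) (y z : R), y ∈ L → y * z ∈ L :=
      fun L y z hy ↦ L.smul_mem (.op z) hy
    refine Submodule.mem_sup.mpr ⟨(j + k) * (1 - e), ⟨mul_mem _ _ _ hx, ?_⟩, (j + k) * e,
      ⟨mul_mem _ _ _ hx, ?_⟩, by ring⟩
    · rw [add_mul, hs]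
      exact J.add_mem (mul_mem _ _ _ hj) (mul_mem _ _ _ hj)
    · rw [add_mul, hr]
      exact K.add_mem (mul_mem _ _ _ hk) (mul_mem _ _ _ hk)

/-- Divisibility is total in the localization of a distributive commutative ring at a prime. -/
theorem Localization.AtPrime.dvd_total_of_exists_dvd {R : Type*} [CommRing R]
    (h : ∀ a b : R, ∃ e, b ∣ a * e ∧ a ∣ b * (1 - e)) (P : Ideal R) [P.IsPrime]
    (x y : Localization.AtPrime P) : x ∣ y ∨ y ∣ x := by
  obtain ⟨⟨a, s⟩, ha⟩ := IsLocalization.surj P.primeCompl x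
  obtain ⟨⟨b, t⟩, hb⟩ := IsLocalization.surj P.primeCompl y
  have unit : ∀ e : R, e ∉ P → IsUnit (algebraMap R (Localization.AtPrime P) e) := fun e he ↦
    IsLocalization.map_units (M := P.primeCompl) _ ⟨e, he⟩
  obtain ⟨e, hbe, hae⟩ := h a b
  have hbe := map_dvd (algebraMap R (Localization.AtPrime P)) hbe
  have hae := map_dvd (algebraMap R (Localization.AtPrime P)) hae
  simp only at ha hb
  rw [map_mul, ← ha, ← hb] at hbe hae
  by_cases he : e ∈ P
  · have he' : 1 - e ∉ P := fun h' ↦ (Ideal.ne_top_iff_one P).mp Ideal.IsPrime.ne_top'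
      (by simpa using P.add_mem h' he)
    left
    rwa [(unit _ he').dvd_mul_right, (unit _ t.2).dvd_mul_right, (unit _ s.2).mul_right_dvd] at hae
  · right
    rwa [(unit _ he).dvd_mul_right, (unit _ t.2).mul_right_dvd, (unit _ s.2).dvd_mul_right] at hbe

/-- A nontrivial reduced commutative ring with total divisibility is a domain. -/
theorem IsDomain.of_dvd_total {R : Type*} [CommRing R] [Nontrivial R] [IsReduced R]
    (h : ∀ x y : R, x ∣ y ∨ y ∣ x) : IsDomain R := by
  have : NoZeroDivisors R := by
    refine ⟨fun {x y} hxy ↦ ?_⟩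
    rcases h x y with ⟨z, rfl⟩ | ⟨z, rfl⟩
    · exact .inr (IsReduced.eq_zero _ ⟨2, by linear_combination z * hxy⟩)
    · exact .inl (IsReduced.eq_zero _ ⟨2, by linear_combination z * hxy⟩)
  exact NoZeroDivisors.to_isDomain R

/-- Submodules of flat modules over a reduced distributive commutative ring are flat. -/
theorem Module.Flat.submodule_of_exists_dvd {R : Type*} [CommRing R] [IsReduced R]
    (h : ∀ a b : R, ∃ e, b ∣ a * e ∧ a ∣ b * (1 - e)) {M : Type*} [AddCommGroup M] [Module R M]
    [Module.Flat R M] (N : Submodule R M) : Module.Flat R N := by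
  refine Module.flat_of_localized_maximal _ fun P _ ↦ ?_
  have total := Localization.AtPrime.dvd_total_of_exists_dvd h P
  have : IsReduced (Localization P.primeCompl) :=
    isReduced_localizationPreserves P.primeCompl _ inferInstance
  have : IsDomain (Localization P.primeCompl) := .of_dvd_total total
  have : ValuationRing (Localization P.primeCompl) := ValuationRing.iff_dvd_total.mpr ⟨total⟩
  have : Module.Flat (Localization P.primeCompl) (LocalizedModule P.primeCompl M) :=
    .of_isLocalizedModule _ P.primeCompl (LocalizedModule.mkLinearMap P.primeCompl M)
  have : Module.IsTorsionFree (Localization P.primeCompl) (LocalizedModule P.primeCompl N) :=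
    Function.Injective.moduleIsTorsionFree (LocalizedModule.map P.primeCompl N.subtype)
      (LocalizedModule.map_injective _ _ N.subtype_injective) fun c x ↦ map_smul _ c x
  rw [← Module.flat_iff_of_isLocalization (Localization P.primeCompl) P.primeCompl,
    flat_iff_torsion_eq_bot_of_isBezout, ← Submodule.isTorsionFree_iff_torsion_eq_bot]
  infer_instance

/-- A commutative ring whose principal ideals are flat is reduced. -/
theorem eq_zero_of_mul_self_eq_zero_of_flat {R : Type*} [CommRing R] {a : R}
    [Module.Flat R (Ideal.span {a})] (ha : a * a = 0) : a = 0 := by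
  have rel : ∑ i : Fin 1, (fun _ ↦ a) i •
      (fun _ ↦ ⟨a, Ideal.mem_span_singleton_self a⟩ : Fin 1 → Ideal.span {a}) i = 0 :=
    Subtype.ext (by simpa using ha)
  obtain ⟨k, c, y, hy, hc⟩ := Module.Flat.isTrivialRelation_of_sum_smul_eq_zero rel
  have hy := congrArg Subtype.val (hy 0)
  simp only [AddSubmonoidClass.coe_finsetSum, Submodule.coe_smul, smul_eq_mul] at hy
  rw [hy]
  refine Finset.sum_eq_zero fun j _ ↦ ?_
  obtain ⟨z, hz⟩ := Ideal.mem_span_singleton.mp (y j).2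
  have := hc j
  simp only [Finset.univ_unique, Finset.sum_singleton] at this
  rw [hz]
  linear_combination z * this

/-- If the ideal generated by `a` and `b` is flat, then `a` and `b` divide each other up to
complementary multipliers. -/
theorem exists_dvd_of_flat_span_pair {R : Type*} [CommRing R] (a b : R)
    [Module.Flat R (Ideal.span {a, b})] : ∃ e, b ∣ a * e ∧ a ∣ b * (1 - e) := by
  have rel : ∑ i : Fin 2, ![b, -a] i •
      (![⟨a, Ideal.subset_span (by simp)⟩, ⟨b, Ideal.subset_span (by simp)⟩] :
        Fin 2 → Ideal.span {a, b}) i = 0 :=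
    Subtype.ext (by simp [Fin.sum_univ_two, mul_comm])
  obtain ⟨k, c, y, hy, hc⟩ := Module.Flat.isTrivialRelation_of_sum_smul_eq_zero rel
  choose s t hst using fun j ↦ Ideal.mem_span_pair.mp (y j).2
  have hya := congrArg Subtype.val (hy 0)
  have hyb := congrArg Subtype.val (hy 1)
  simp only [AddSubmonoidClass.coe_finsetSum, Submodule.coe_smul, smul_eq_mul,
    Matrix.cons_val_zero, Matrix.cons_val_one, ← hst] at hya hyb
  simp only [Fin.sum_univ_two, Matrix.cons_val_zero, Matrix.cons_val_one] at hc
  have hq : a * ∑ j, c 1 j * t j = b * ∑ j, c 0 j * t j := by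
    simp only [Finset.mul_sum]
    exact Finset.sum_congr rfl fun j _ ↦ by linear_combination -t j * hc j
  have hb : b = b * ∑ j, c 1 j * t j + a * ∑ j, c 1 j * s j := by
    nth_rewrite 1 [hyb]
    simp only [Finset.mul_sum, ← Finset.sum_add_distrib]
    exact Finset.sum_congr rfl fun j _ ↦ by ring
  exact ⟨∑ j, c 1 j * t j, ⟨_, hq⟩, ⟨∑ j, c 1 j * s j, by linear_combination hb⟩⟩

/-- A commutative ring is semiprime and distributive if and only if submodules of flat modules
are flat. -/
theorem semiprime_isRightDistributive_iff_flatSubmodules {R : Type u} [CommRing R] :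
    ((∀ a : R, (∀ x : R, a * x * a = 0) → a = 0) ∧ IsRightDistributive R) ↔
      ∀ (M : Type u) [AddCommGroup M] [Module R M],
        Module.Flat R M → ∀ N : Submodule R M, Module.Flat R N := by
  rw [isRightDistributive_iff_exists_dvd]
  constructor
  · rintro ⟨hsp, h⟩ M _ _ _ N
    have : IsReduced R := (isReduced_iff_pow_one_lt 2 one_lt_two).mpr fun a ha ↦
      hsp a fun x ↦ by linear_combination x * ha
    exact Module.Flat.submodule_of_exists_dvd h N
  · intro h
    refine ⟨fun a ha ↦ ?_, fun a b ↦ ?_⟩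
    · have := h R inferInstance (Ideal.span {a})
      exact eq_zero_of_mul_self_eq_zero_of_flat (by simpa using ha 1)
    · have := h R inferInstance (Ideal.span {a, b})
      exact exists_dvd_of_flat_span_pair a b

/-- A centrally essential ring `A` is a semiprime, right distributive ring if and only if
`A` is commutative and every submodule of every flat `A`-module is flat. -/
theorem centrallyEssential_semiprime_rightDistributive_iff {A : Type u} [Ring A]
    [Nontrivial A] (hCE : IsCentrallyEssential A) :
    ((∀ a : A, (∀ x : A, a * x * a = 0) → a = 0) ∧ IsRightDistributive A) ↔
      ∃ h : ∀ x y : A, x * y = y * x, FlatSubmodulesOfFlatAreFlat A h := by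
  have key (h : ∀ x y : A, x * y = y * x) :
      ((∀ a : A, (∀ x : A, a * x * a = 0) → a = 0) ∧ IsRightDistributive A) ↔
        FlatSubmodulesOfFlatAreFlat A h :=
    letI := Ring.commRingOfComm A h
    semiprime_isRightDistributive_iff_flatSubmodules (R := A)
  exact ⟨fun hA ↦ ⟨hCE.mul_comm_of_semiprime hA.1, (key _).mp hA⟩, fun ⟨h, hA⟩ ↦ (key h).mpr hA⟩
end

section
/- Let A be a centrally essential, semiprime, right distributive ring that does not contain an infinite direct sum of nonzero (two-sided) ideals. Then A is isomorphic to a finite direct product of commutative semihereditary integral domains. -/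
universe u

/-- Any two elements of a right distributive ring are comparable up to a partition of unity. -/
theorem IsRightDistributive.exists_comparison {A : Type*} [Ring A] (h : IsRightDistributive A)
    (x y : A) : ∃ t r s : A, x * (1 - t) = y * r ∧ y * t = x * s := by
  have hx : x ∈ Submodule.span Aᵐᵒᵖ {x} ⊓
      (Submodule.span Aᵐᵒᵖ {y} ⊔ Submodule.span Aᵐᵒᵖ {x - y}) := by
    refine ⟨Submodule.mem_span_singleton_self x, ?_⟩
    exact Submodule.mem_sup.2 ⟨y, Submodule.mem_span_singleton_self y, x - y,
      Submodule.mem_span_singleton_self _, by abel⟩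
  rw [h] at hx
  obtain ⟨u, ⟨-, huy⟩, v, ⟨hvx, hvxy⟩, huv⟩ := Submodule.mem_sup.1 hx
  obtain ⟨r, hr⟩ := Submodule.mem_span_singleton.1 huy
  obtain ⟨s, hs⟩ := Submodule.mem_span_singleton.1 hvx
  obtain ⟨t, ht⟩ := Submodule.mem_span_singleton.1 hvxy
  simp only [MulOpposite.smul_eq_mul_unop] at hr hs ht
  refine ⟨t.unop, r.unop - t.unop, t.unop - s.unop, ?_, ?_⟩
  · rw [mul_sub, mul_sub, hr, mul_one]
    rw [sub_mul] at ht
    rw [← ht] at huv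
    nth_rewrite 1 [← huv]
    abel
  · rw [mul_sub, hs, ← ht, sub_mul]
    abel

/-- In a commutative reduced ring, an infinite orthogonal family of nonzero elements generates an
infinite independent family of ideals. -/
theorem iSupIndep_span_of_mul_eq_zero {A : Type*} [Ring A] (hcomm : ∀ a b : A, a * b = b * a)
    (hsq : ∀ a : A, a * a = 0 → a = 0) {ι : Type*} (w : ι → A)
    (hw : ∀ m n, m ≠ n → w m * w n = 0) :
    iSupIndep fun k => TwoSidedIdeal.span {w k} := by
  let ann (x : A) : TwoSidedIdeal A := TwoSidedIdeal.mk' {y | x * y = 0} (mul_zero x)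
    (fun {y z} hy hz => by simp only [Set.mem_ofPred_eq] at *; rw [mul_add, hy, hz, add_zero])
    (fun {y} hy => by simp only [Set.mem_ofPred_eq] at *; rw [mul_neg, hy, neg_zero])
    (fun {y z} hz => by
      simp only [Set.mem_ofPred_eq] at *; rw [hcomm y z, ← mul_assoc, hz, zero_mul])
    (fun {y z} hy => by simp only [Set.mem_ofPred_eq] at *; rw [← mul_assoc, hy, zero_mul])
  have mem_ann (x y : A) : y ∈ ann x ↔ x * y = 0 := TwoSidedIdeal.mem_mk' ..
  have span_le (x y : A) (h : x * y = 0) : TwoSidedIdeal.span {y} ≤ ann x := by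
    rw [TwoSidedIdeal.span_le]
    rintro _ rfl
    exact (mem_ann _ _).2 h
  intro i
  rw [disjoint_iff, eq_bot_iff]
  intro x hx
  rw [TwoSidedIdeal.mem_inf] at hx
  have h1 : (⨆ j, ⨆ _ : j ≠ i, TwoSidedIdeal.span {w j}) ≤ ann (w i) :=
    iSup₂_le fun j hj => span_le _ _ (hw i j hj.symm)
  have h2 : w i * x = 0 := (mem_ann _ _).1 (h1 hx.2)
  have h3 : x * x = 0 := (mem_ann _ _).1 (span_le x (w i) (by rw [hcomm, h2]) hx.1)
  exact (TwoSidedIdeal.mem_bot _).2 (hsq x h3)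

section CommRing

variable {R : Type*} [CommRing R]

/-- A partition of unity which makes a finitely generated ideal locally principal. -/
theorem exists_sum_eq_one_dvd_mul (harith : ∀ x y : R, ∃ t, y ∣ x * (1 - t) ∧ x ∣ y * t)
    {s : Finset R} (hs : s.Nonempty) :
    ∃ t : R → R, ∑ x ∈ s, t x = 1 ∧ ∀ x ∈ s, ∀ y ∈ s, x ∣ t x * y := by
  classical
  induction hs using Finset.Nonempty.cons_induction with
  | singleton a => exact ⟨fun _ => 1, by simp, by simp⟩
  | cons a s ha hs ih =>
    obtain ⟨t, ht, hdvd⟩ := ih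
    choose c hc hc' using fun x => harith x a
    have hne : ∀ x ∈ s, x ≠ a := fun x hx h => ha (h ▸ hx)
    refine ⟨fun x => if x = a then ∑ y ∈ s, t y * (1 - c y) else t x * c x, ?_, ?_⟩
    · rw [Finset.sum_cons, if_pos rfl,
        Finset.sum_congr rfl fun x hx => if_neg (hne x hx), ← Finset.sum_add_distrib]
      refine Eq.trans ?_ ht
      exact Finset.sum_congr rfl fun x _ => by ring
    · intro x hx y hy
      rcases Finset.mem_cons.1 hx with rfl | hx
      · rcases Finset.mem_cons.1 hy with rfl | hy
        · exact dvd_mul_left _ _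
        · beta_reduce
          rw [if_pos rfl, Finset.sum_mul]
          refine Finset.dvd_sum fun z hz => ?_
          obtain ⟨k, hk⟩ := hdvd z hz y hy
          have : t z * (1 - c z) * y = z * (1 - c z) * k := by
            linear_combination (1 - c z) * hk
          exact this ▸ (hc z).mul_right k
      · beta_reduce
        rw [if_neg (hne x hx)]
        rcases Finset.mem_cons.1 hy with rfl | hy
        · exact mul_assoc (t x) (c x) y ▸ (mul_comm y (c x) ▸ hc' x).mul_left _
        · exact mul_right_comm (t x) (c x) y ▸ (hdvd x hx y hy).mul_right _

/-- Finitely generated ideals of an arithmetical domain are projective. -/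
theorem Ideal.FG.projective_of_arithmetical [IsDomain R]
    (harith : ∀ x y : R, ∃ t, y ∣ x * (1 - t) ∧ x ∣ y * t) {I : Ideal R} (hI : I.FG) :
    Module.Projective R I := by
  classical
  obtain ⟨s, rfl⟩ := hI
  rcases s.eq_empty_or_nonempty with rfl | hs
  · rw [Finset.coe_empty, Ideal.span, Submodule.span_empty]
    infer_instance
  obtain ⟨t, ht, hdvd⟩ := exists_sum_eq_one_dvd_mul harith hs
  set I : Ideal R := Submodule.span R (s : Set R)
  have hmem : ∀ x ∈ s, ∀ y ∈ I, t x * y ∈ Submodule.span R {x} := by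
    intro x hx y hy
    have : I ≤ (Submodule.span R {x}).comap (LinearMap.mulLeft R (t x)) :=
      Submodule.span_le.2 fun z hz => Ideal.mem_span_singleton.2 (hdvd x hx z hz)
    exact this hy
  have hφ : ∀ x ∈ s, ∃ φ : I →ₗ[R] R, ∀ y : I, x * φ y = t x * y := by
    intro x hx
    by_cases hx0 : x = 0
    · refine ⟨0, fun y => ?_⟩
      have := hmem x hx y y.2
      rw [hx0, Submodule.span_zero_singleton, Submodule.mem_bot] at this
      rw [hx0, this, zero_mul]
    · let g : I →ₗ[R] Submodule.span R {x} :=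
        ((LinearMap.mulLeft R (t x)).comp I.subtype).codRestrict _ fun y => hmem x hx y y.2
      let e := LinearEquiv.toSpanNonzeroSingleton R R x hx0
      refine ⟨e.symm.toLinearMap.comp g, fun y => ?_⟩
      have h : (e (e.symm (g y)) : R) = t x * y := by rw [e.apply_symm_apply]; rfl
      rw [← h, mul_comm]
      rfl
  choose φ hφ using fun x : s => hφ x x.2
  let i : I →ₗ[R] (s → R) := LinearMap.pi φ
  let p : (s → R) →ₗ[R] I :=
    Fintype.linearCombination R fun x : s => (⟨x, Submodule.subset_span x.2⟩ : I)
  refine Module.Projective.of_split i p (LinearMap.ext fun y => Subtype.ext ?_)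
  have h : ((p (i y) : I) : R) = ∑ x : s, φ x y * x := by
    simp [p, i, Fintype.linearCombination_apply]
  change ((p (i y) : I) : R) = y
  calc ((p (i y) : I) : R) = ∑ x : s, t x * (y : R) := by
        rw [h]; exact Finset.sum_congr rfl fun x _ => by rw [mul_comm, hφ]
    _ = y := by rw [Finset.sum_coe_sort s fun x => t x * (y : R), ← Finset.sum_mul, ht, one_mul]

/-- In a commutative ring without infinite orthogonal families of nonzero elements, the ascending
chain condition holds for annihilators of elements. -/
theorem wellFounded_ker_mulLeft_gt
    (horth : ∀ w : ℕ → R, (∀ n, w n ≠ 0) → ¬∀ m n, m < n → w m * w n = 0) :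
    WellFounded fun x y : R =>
      LinearMap.ker (LinearMap.mulLeft R y) < LinearMap.ker (LinearMap.mulLeft R x) := by
  rw [wellFounded_iff_isEmpty_descending_chain]
  refine ⟨fun ⟨c, hc⟩ => ?_⟩
  have hmono := (strictMono_nat_of_lt_succ
    (f := fun n => LinearMap.ker (LinearMap.mulLeft R (c n))) hc).monotone
  choose z hz hz' using fun n => SetLike.exists_of_lt (hc n)
  simp only [LinearMap.mem_ker, LinearMap.mulLeft_apply] at hz hz'
  refine horth (fun n => c n * z n) hz' fun m n hmn => ?_
  have h : c n * z m = 0 := hmono (Nat.succ_le_of_lt hmn) (hz m)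
  linear_combination c m * z n * h

/-- In a commutative ring without infinite orthogonal families of nonzero elements, the descending
chain condition holds for annihilators of elements. -/
theorem wellFounded_ker_mulLeft_lt
    (horth : ∀ w : ℕ → R, (∀ n, w n ≠ 0) → ¬∀ m n, m < n → w m * w n = 0) :
    WellFounded fun x y : R =>
      LinearMap.ker (LinearMap.mulLeft R x) < LinearMap.ker (LinearMap.mulLeft R y) := by
  rw [wellFounded_iff_isEmpty_descending_chain]
  refine ⟨fun ⟨c, hc⟩ => ?_⟩
  have hanti := (strictAnti_nat_of_succ_lt
    (f := fun n => LinearMap.ker (LinearMap.mulLeft R (c n))) hc).antitone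
  choose z hz hz' using fun n => SetLike.exists_of_lt (hc n)
  simp only [LinearMap.mem_ker, LinearMap.mulLeft_apply] at hz hz'
  refine horth (fun n => c (n + 1) * z n) hz' fun m n hmn => ?_
  have h : c (m + 1) * z n = 0 := hanti (Nat.succ_le_of_lt hmn) (hz n)
  linear_combination c (n + 1) * z m * h

/-- Every element of a reduced ring without infinite orthogonal families has an orthogonal
complement. -/
theorem exists_mul_eq_zero_and_forall_eq_zero (hsq : ∀ a : R, a * a = 0 → a = 0)
    (horth : ∀ w : ℕ → R, (∀ n, w n ≠ 0) → ¬∀ m n, m < n → w m * w n = 0) (x : R) :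
    ∃ c, x * c = 0 ∧ ∀ z, x * z = 0 → c * z = 0 → z = 0 := by
  obtain ⟨c, hxc, hmin⟩ :=
    (wellFounded_ker_mulLeft_lt horth).has_min {c | x * c = 0} ⟨0, mul_zero x⟩
  have hxc : x * c = 0 := hxc
  refine ⟨c, hxc, fun z hxz hcz => ?_⟩
  by_contra hz
  refine hmin (c + z) (show x * (c + z) = 0 by rw [mul_add, hxc, hxz, add_zero]) ?_
  refine SetLike.lt_iff_le_and_exists.2 ⟨fun y hy => ?_, z, hcz, fun h => ?_⟩
  · have hy : (c + z) * y = 0 := hy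
    refine hsq _ ?_
    change (c * y) * (c * y) = 0
    linear_combination c * y * hy - y * y * hcz
  · have h : (c + z) * z = 0 := h
    exact hz (hsq z (by linear_combination h - hcz))

/-- In an arithmetical reduced ring without infinite orthogonal families, the annihilator of an
element is a finite intersection of pairwise comaximal primes. -/
theorem exists_finset_isPrime_inf_eq_ker_mulLeft (hsq : ∀ a : R, a * a = 0 → a = 0)
    (horth : ∀ w : ℕ → R, (∀ n, w n ≠ 0) → ¬∀ m n, m < n → w m * w n = 0)
    (harith : ∀ x y : R, ∃ t, y ∣ x * (1 - t) ∧ x ∣ y * t) (x : R) :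
    ∃ S : Finset (Ideal R), (∀ p ∈ S, p.IsPrime) ∧
      (∀ p ∈ S, ∀ q ∈ S, p ≠ q → IsCoprime p q) ∧
      S.inf id = LinearMap.ker (LinearMap.mulLeft R x) := by
  classical
  induction x using (wellFounded_ker_mulLeft_gt horth).induction with
  | _ x ih =>
  by_cases hx : x = 0
  · exact ⟨∅, by simp, by simp, by ext; simp [hx]⟩
  by_cases hp : Ideal.IsPrime (LinearMap.ker (LinearMap.mulLeft R x))
  · exact ⟨{LinearMap.ker (LinearMap.mulLeft R x)}, by simpa using hp, by simp, by simp⟩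
  have hab : ∃ a b, x * (a * b) = 0 ∧ x * a ≠ 0 ∧ x * b ≠ 0 := by
    by_contra! hab
    refine hp (Ideal.isPrime_iff.2 ⟨fun h => hx ?_, fun {a b} h => ?_⟩)
    · have : x * 1 = 0 := (Ideal.eq_top_iff_one _).1 h
      simpa using this
    · exact or_iff_not_imp_left.2 fun ha => hab a b h ha
  obtain ⟨a, b, hxab, ha, hb⟩ := hab
  obtain ⟨c, hc, hc'⟩ := exists_mul_eq_zero_and_forall_eq_zero hsq horth (x * a)
  have hle : ∀ u, LinearMap.ker (LinearMap.mulLeft R x) ≤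
      LinearMap.ker (LinearMap.mulLeft R (x * u)) := by
    intro u y hy
    have hy : x * y = 0 := hy
    change x * u * y = 0
    linear_combination u * hy
  obtain ⟨S, hS, hS', hSe⟩ := ih (x * a) (SetLike.lt_iff_le_and_exists.2
    ⟨hle a, b, show x * a * b = 0 by rw [mul_assoc, hxab], hb⟩)
  obtain ⟨T, hT, hT', hTe⟩ := ih (x * c) (SetLike.lt_iff_le_and_exists.2
    ⟨hle c, a, show x * c * a = 0 by linear_combination hc, ha⟩)
  have hcop : IsCoprime (LinearMap.ker (LinearMap.mulLeft R (x * a)) : Ideal R)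
      (LinearMap.ker (LinearMap.mulLeft R (x * c))) := by
    obtain ⟨t, ⟨r, hr⟩, ⟨s, hs⟩⟩ := harith (x * a) (x * c)
    refine Ideal.isCoprime_iff_exists.2 ⟨1 - t, hsq _ ?_, t, hsq _ ?_, by ring⟩
    · simp only [LinearMap.mulLeft_apply]
      linear_combination (x * a) * (1 - t) * hr + (1 - t) * r * x * hc
    · simp only [LinearMap.mulLeft_apply]
      linear_combination (x * c) * t * hs + t * s * x * hc
  have hST : ∀ p ∈ S, ∀ q ∈ T, IsCoprime p q := fun p hp q hq => by
    rw [Ideal.isCoprime_iff_sup_eq, eq_top_iff, ← Ideal.isCoprime_iff_sup_eq.1 hcop, ← hSe, ← hTe]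
    exact sup_le_sup (Finset.inf_le (f := id) hp) (Finset.inf_le (f := id) hq)
  refine ⟨S ∪ T, fun p hp => (Finset.mem_union.1 hp).elim (hS p) (hT p), ?_, ?_⟩
  · intro p hp q hq hpq
    rcases Finset.mem_union.1 hp with hp | hp <;> rcases Finset.mem_union.1 hq with hq | hq
    · exact hS' p hp q hq hpq
    · exact hST p hp q hq
    · exact (hST q hq p hp).symm
    · exact hT' p hp q hq hpq
  · rw [Finset.inf_union, hSe, hTe]
    refine le_antisymm (fun y hy => ?_) (le_inf (hle a) (hle c))
    have h1 : x * a * y = 0 := hy.1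
    have h2 : x * c * y = 0 := hy.2
    exact hc' (x * y) (by linear_combination x * h1) (by linear_combination h2)

/-- A reduced arithmetical ring without infinite orthogonal families is a finite product of
semihereditary domains. -/
theorem exists_ringEquiv_pi_isDomain {R : Type u} [CommRing R] (hsq : ∀ a : R, a * a = 0 → a = 0)
    (horth : ∀ w : ℕ → R, (∀ n, w n ≠ 0) → ¬∀ m n, m < n → w m * w n = 0)
    (harith : ∀ x y : R, ∃ t, y ∣ x * (1 - t) ∧ x ∣ y * t) :
    ∃ (n : ℕ) (B : Fin n → Type u) (instB : ∀ i, CommRing (B i)),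
      letI := instB
      Nonempty (R ≃+* ∀ i, B i) ∧
        ∀ i, IsDomain (B i) ∧ ∀ I : Ideal (B i), I.FG → Module.Projective (B i) I := by
  obtain ⟨S, hS, hcop, hSe⟩ := exists_finset_isPrime_inf_eq_ker_mulLeft hsq horth harith 1
  let P : Fin S.card → Ideal R := fun i => S.equivFin.symm i
  have hP : ⨅ i, P i = ⊥ := by
    have h0 : LinearMap.ker (LinearMap.mulLeft R (1 : R)) = ⊥ := by ext; simp
    rw [← h0, ← hSe, Finset.inf_eq_iInf]
    exact (S.equivFin.symm.iInf_comp (g := fun p : S => (p : Ideal R))).trans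
      (iInf_subtype (f := fun p : S => (p : Ideal R)))
  have hPc : Pairwise (Function.onFun IsCoprime P) := fun i j hij =>
    hcop _ (S.equivFin.symm i).2 _ (S.equivFin.symm j).2 fun h =>
      hij (S.equivFin.symm.injective (Subtype.ext h))
  refine ⟨S.card, fun i => R ⧸ P i, fun i => inferInstance, ⟨?_⟩, fun i => ?_⟩
  · exact (RingEquiv.quotientBot R).symm.trans
      ((Ideal.quotEquivOfEq hP.symm).trans (Ideal.quotientInfRingEquivPiQuotient P hPc))
  · have : (P i).IsPrime := hS _ (S.equivFin.symm i).2
    have hdom : IsDomain (R ⧸ P i) := inferInstance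
    refine ⟨hdom, fun I hI => hI.projective_of_arithmetical fun x y => ?_⟩
    obtain ⟨x, rfl⟩ := Ideal.Quotient.mk_surjective x
    obtain ⟨y, rfl⟩ := Ideal.Quotient.mk_surjective y
    obtain ⟨t, h1, h2⟩ := harith x y
    exact ⟨Ideal.Quotient.mk _ t, by simpa using map_dvd (Ideal.Quotient.mk (P i)) h1,
      by simpa using map_dvd (Ideal.Quotient.mk (P i)) h2⟩

end CommRing

/-- Let `A` be a centrally essential, semiprime, right distributive ring containing no
infinite direct sum of nonzero two-sided ideals.  Then `A` is isomorphic to a finite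
direct product of commutative semihereditary integral domains. -/
theorem centrallyEssential_semiprime_rightDistributive_structure {A : Type u} [Ring A]
    [Nontrivial A]
    (hCE : IsCentrallyEssential A)
    (hsemiprime : ∀ a : A, (∀ x : A, a * x * a = 0) → a = 0)
    (hdist : IsRightDistributive A)
    (hnosum : ¬∃ f : ℕ → TwoSidedIdeal A, (∀ k, f k ≠ ⊥) ∧ iSupIndep f) :
    ∃ (n : ℕ) (B : Fin n → Type u) (instB : ∀ i, CommRing (B i)),
      letI := instB
      Nonempty (A ≃+* ∀ i, B i) ∧
        ∀ i, IsDomain (B i) ∧ ∀ I : Ideal (B i), I.FG → Module.Projective (B i) I := by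
  have hcomm := hCE.mul_comm_of_semiprime hsemiprime
  have hsq : ∀ a : A, a * a = 0 → a = 0 := fun a ha =>
    hsemiprime a fun x => by rw [hcomm a x, mul_assoc, ha, mul_zero]
  have horth : ∀ w : ℕ → A, (∀ n, w n ≠ 0) → ¬∀ m n, m < n → w m * w n = 0 := by
    intro w hw hmul
    refine hnosum ⟨fun k => TwoSidedIdeal.span {w k}, fun k hk => hw k ?_,
      iSupIndep_span_of_mul_eq_zero hcomm hsq w fun m n hmn => ?_⟩
    · have hk : TwoSidedIdeal.span {w k} = ⊥ := hk
      have : w k ∈ TwoSidedIdeal.span {w k} := TwoSidedIdeal.subset_span rfl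
      rwa [hk, TwoSidedIdeal.mem_bot] at this
    · rcases lt_or_gt_of_ne hmn with h | h
      · exact hmul m n h
      · rw [hcomm, hmul n m h]
  let _ : CommRing A := { ‹Ring A› with mul_comm := hcomm }
  refine exists_ringEquiv_pi_isDomain hsq horth fun x y => ?_
  obtain ⟨t, r, s, h1, h2⟩ := hdist.exists_comparison x y
  exact ⟨t, ⟨r, h1⟩, ⟨s, h2⟩⟩
end

section
/- Let A be a right distributive indecomposable ring satisfying the maximum condition on right annihilators and containing no infinite direct sum of nonzero right ideals, and suppose A is not a right uniform domain. Then the prime radical B of A is a nonzero, completely prime, nilpotent ideal, B equals the set of all left zero-divisors of A, B is an essential right ideal of A, and B = aB for every element a ∈ A \ B. -/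
/-- The set of left zero-divisors of a ring. -/
def leftZeroDivisors (A : Type*) [Ring A] : Set A :=
  {a : A | ∃ x : A, x ≠ 0 ∧ a * x = 0}

/-- A two-sided ideal `P` of a ring `A` is *prime* if `P ≠ A` and, for all `a, b ∈ A`,
`a A b ⊆ P` implies `a ∈ P` or `b ∈ P`. -/
def TwoSidedIdeal.IsPrimeIdeal {A : Type*} [Ring A] (P : TwoSidedIdeal A) : Prop :=
  P ≠ ⊤ ∧ ∀ a b : A, (∀ x : A, a * x * b ∈ P) → a ∈ P ∨ b ∈ P

/-- The *prime radical* of a ring: the intersection of all prime two-sided ideals. -/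
def primeRadical (A : Type*) [Ring A] : TwoSidedIdeal A :=
  sInf {P : TwoSidedIdeal A | P.IsPrimeIdeal}

/-- A subset of a ring is a right annihilator if it is the right annihilator
`r(S) = {a | S a = 0}` of some subset `S`. -/
def IsRightAnnihilator {A : Type*} [Ring A] (T : Set A) : Prop :=
  ∃ S : Set A, T = {a : A | ∀ s ∈ S, s * a = 0}

section RightIdeals

variable {A : Type*} [Ring A]

theorem mul_mem_rightIdeal {I : Submodule Aᵐᵒᵖ A} {x : A} (hx : x ∈ I) (c : A) : x * c ∈ I :=
  I.smul_mem (MulOpposite.op c) hx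

theorem mem_span_singleton_mulOpposite {x y : A} :
    y ∈ Submodule.span Aᵐᵒᵖ {x} ↔ ∃ c : A, x * c = y := by
  rw [Submodule.mem_span_singleton]
  constructor
  · rintro ⟨c, rfl⟩
    exact ⟨c.unop, rfl⟩
  · rintro ⟨c, rfl⟩
    exact ⟨MulOpposite.op c, rfl⟩

/-- Stephenson's elementwise consequence of right distributivity. -/
theorem IsRightDistributive.exists_mul_eq_s18 (hdist : IsRightDistributive A) (a b : A) :
    ∃ t : A, (∃ c, b * c = a * t) ∧ ∃ d, a * d = b * (1 - t) := by
  have h := hdist (Submodule.span Aᵐᵒᵖ {a}) (Submodule.span Aᵐᵒᵖ {a + b})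
    (Submodule.span Aᵐᵒᵖ {b})
  have ha : a ∈ Submodule.span Aᵐᵒᵖ {a} ⊓
      (Submodule.span Aᵐᵒᵖ {a + b} ⊔ Submodule.span Aᵐᵒᵖ {b}) := by
    refine ⟨Submodule.mem_span_singleton_self a, Submodule.mem_sup.2
      ⟨a + b, Submodule.mem_span_singleton_self _, -b, ?_, by abel⟩⟩
    exact neg_mem (Submodule.mem_span_singleton_self b)
  rw [h] at ha
  obtain ⟨p, ⟨hp1, hp2⟩, w, ⟨hw1, hw2⟩, hpw⟩ := Submodule.mem_sup.1 ha
  obtain ⟨p', hp'⟩ := mem_span_singleton_mulOpposite.1 hp1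
  obtain ⟨s, hs⟩ := mem_span_singleton_mulOpposite.1 hp2
  obtain ⟨w', hw'⟩ := mem_span_singleton_mulOpposite.1 hw2
  refine ⟨1 - s, ⟨s + w', ?_⟩, p' - s, ?_⟩
  · rw [mul_add, hw', eq_sub_of_add_eq' hpw, ← hs]
    noncomm_ring
  · rw [mul_sub, hp', ← hs]
    noncomm_ring

/-- In a right distributive ring, left multiplication maps no right ideal nontrivially into
a right ideal disjoint from it. -/
theorem IsRightDistributive.mul_eq_zero (hdist : IsRightDistributive A) {a x : A}
    (h : ∀ c d : A, x * c = a * x * d → x * c = 0) : a * x = 0 := by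
  obtain ⟨t, ⟨c, hc⟩, d, hd⟩ := hdist.exists_mul_eq_s18 x (a * x)
  have h1 : x * t = 0 := h t c hc.symm
  have h2 : x * d = 0 := h d (1 - t) hd
  have h3 : a * x * t = 0 := by rw [mul_assoc, h1, mul_zero]
  rw [h2, mul_sub, mul_one, h3, sub_zero] at hd
  exact hd.symm

theorem IsRightDistributive.exists_common_multiple (hdist : IsRightDistributive A) {a x : A}
    (h : a * x ≠ 0) : ∃ c d : A, x * c = a * x * d ∧ x * c ≠ 0 := by
  by_contra! hc
  exact h (hdist.mul_eq_zero hc)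

theorem IsRightDistributive.mul_eq_zero_of_disjoint (hdist : IsRightDistributive A)
    {I J : Submodule Aᵐᵒᵖ A} (hIJ : Disjoint I J) {x y : A} (hx : x ∈ I) (hy : y ∈ J) :
    x * y = 0 := by
  refine hdist.mul_eq_zero fun c d hcd => ?_
  refine Submodule.disjoint_def.1 hIJ _ ?_ (mul_mem_rightIdeal hy c)
  rw [hcd, mul_assoc]
  exact mul_mem_rightIdeal hx _

theorem IsRightDistributive.mem_center_of_isIdempotentElem (hdist : IsRightDistributive A)
    {e : A} (he : e * e = e) : e ∈ Set.center A := by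
  have key : ∀ f : A, f * f = f → ∀ a, f * a * (1 - f) = 0 := by
    intro f hf a
    refine hdist.mul_eq_zero fun c d hcd => ?_
    have h1 : (1 - f) * (1 - f) = 1 - f := by
      rw [mul_sub, mul_one, sub_mul, one_mul, hf]
      simp
    have h2 : (1 - f) * f = 0 := by rw [sub_mul, one_mul, hf, sub_self]
    calc (1 - f) * c = (1 - f) * ((1 - f) * c) := by rw [← mul_assoc, h1]
      _ = (1 - f) * f * (a * (1 - f) * d) := by rw [hcd]; simp only [mul_assoc]
      _ = 0 := by rw [h2, zero_mul]
  rw [Semigroup.mem_center_iff]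
  intro a
  have h1 := key e he a
  have h2 := key (1 - e) (by rw [mul_sub, mul_one, sub_mul, one_mul, he]; simp) a
  rw [sub_sub_cancel, sub_mul, one_mul, sub_mul, sub_eq_zero] at h2
  rw [mul_sub, mul_one, sub_eq_zero] at h1
  rw [h1, h2]

theorem IsRightDistributive.iSupIndep_of_pairwise_disjoint (hdist : IsRightDistributive A)
    {ι : Type*} {f : ι → Submodule Aᵐᵒᵖ A} (hf : ∀ i j, i ≠ j → Disjoint (f i) (f j)) :
    iSupIndep f := by
  classical
  rw [iSupIndep_iff_supIndep]
  intro s t hts i _ hit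
  induction t using Finset.induction_on with
  | empty => simp
  | insert j t _ ih =>
    have hij : i ≠ j := fun h => hit (h ▸ Finset.mem_insert_self _ _)
    have hdisj := ih ((Finset.subset_insert _ _).trans hts)
      fun h => hit (Finset.mem_insert_of_mem h)
    rw [Finset.sup_insert, disjoint_iff, hdist, disjoint_iff.1 (hf i j hij),
      disjoint_iff.1 hdisj, sup_bot_eq]

/-- A right ideal is uniform if it is nonzero and any two nonzero right ideals inside it
meet nontrivially. -/
def IsUniformRightIdeal (U : Submodule Aᵐᵒᵖ A) : Prop :=
  U ≠ ⊥ ∧ ∀ I J : Submodule Aᵐᵒᵖ A, I ≤ U → J ≤ U → I ≠ ⊥ → J ≠ ⊥ → ¬Disjoint I J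

theorem IsRightDistributive.exists_isUniformRightIdeal_le (hdist : IsRightDistributive A)
    (hnosum : ¬∃ f : ℕ → Submodule Aᵐᵒᵖ A, (∀ k, f k ≠ ⊥) ∧ iSupIndep f)
    {I : Submodule Aᵐᵒᵖ A} (hI : I ≠ ⊥) : ∃ U ≤ I, IsUniformRightIdeal U := by
  by_contra! hno
  let S := {Y : Submodule Aᵐᵒᵖ A // Y ≤ I ∧ Y ≠ ⊥}
  have step : ∀ Y : S, ∃ (X : Submodule Aᵐᵒᵖ A) (Y' : S),
      X ≤ Y.1 ∧ Y'.1 ≤ Y.1 ∧ X ≠ ⊥ ∧ Disjoint X Y'.1 := by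
    rintro ⟨Y, hYI, hY⟩
    have h := hno Y hYI
    unfold IsUniformRightIdeal at h
    push Not at h
    obtain ⟨X, Y', hX, hY', hX0, hY0, hd⟩ := h hY
    exact ⟨X, ⟨Y', hY'.trans hYI, hY0⟩, hX, hY', hX0, hd⟩
  choose X next hXle hnext hX0 hdisj using step
  let g : ℕ → S := fun n => next^[n] ⟨I, le_rfl, hI⟩
  have hg : ∀ n, g (n + 1) = next (g n) := fun n => Function.iterate_succ_apply' _ _ _
  have hanti : Antitone fun n => (g n).1 :=
    antitone_nat_of_succ_le fun n => by rw [hg]; exact hnext _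
  have hlt : ∀ m n, m < n → Disjoint (X (g m)) (X (g n)) := by
    intro m n hmn
    refine (hdisj (g m)).mono_right ((hXle _).trans ?_)
    rw [← hg]
    exact hanti (Nat.succ_le_of_lt hmn)
  refine hnosum ⟨fun n => X (g n), fun n => hX0 _, hdist.iSupIndep_of_pairwise_disjoint ?_⟩
  intro i j hij
  rcases lt_or_gt_of_ne hij with h | h
  · exact hlt _ _ h
  · exact (hlt _ _ h).symm

end RightIdeals

section CompletelyPrime

variable {A : Type*} [Ring A]

/-- A subset of a ring which is a completely prime two-sided ideal. -/
structure IsCompletelyPrimeSet (P : Set A) : Prop where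
  zero_mem : (0 : A) ∈ P
  add_mem : ∀ {x y}, x ∈ P → y ∈ P → x + y ∈ P
  mul_left : ∀ (x) {y}, y ∈ P → x * y ∈ P
  mul_right : ∀ {x} (y), x ∈ P → x * y ∈ P
  one_notMem : (1 : A) ∉ P
  mem_or_mem : ∀ {x y}, x * y ∈ P → x ∈ P ∨ y ∈ P

namespace IsCompletelyPrimeSet

variable {P Q : Set A}

theorem neg_mem (hP : IsCompletelyPrimeSet P) {x : A} (hx : x ∈ P) : -x ∈ P := by
  rw [← neg_one_mul]
  exact hP.mul_left _ hx

theorem pow_notMem (hP : IsCompletelyPrimeSet P) {x : A} (hx : x ∉ P) (n : ℕ) :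
    x ^ n ∉ P := by
  induction n with
  | zero => simpa using hP.one_notMem
  | succ n ih =>
    rw [pow_succ]
    exact fun h => (hP.mem_or_mem h).elim ih hx

/-- If `x ∈ P` then `1 - (1 - x) ^ n ∈ P`. -/
theorem one_sub_one_sub_pow_mem (hP : IsCompletelyPrimeSet P) {x : A} (hx : x ∈ P) (n : ℕ) :
    1 - (1 - x) ^ n ∈ P := by
  induction n with
  | zero => simpa using hP.zero_mem
  | succ n ih =>
    have : 1 - (1 - x) ^ (n + 1) = (1 - (1 - x) ^ n) + (1 - x) ^ n * x := by
      rw [pow_succ]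
      noncomm_ring
    rw [this]
    exact hP.add_mem ih (hP.mul_left _ hx)

theorem pow_mem (hP : IsCompletelyPrimeSet P) {x : A} (hx : x ∈ P) {n : ℕ} (hn : n ≠ 0) :
    x ^ n ∈ P := by
  obtain ⟨m, rfl⟩ := Nat.exists_eq_succ_of_ne_zero hn
  rw [pow_succ]
  exact hP.mul_left _ hx

/-- The two-sided ideal with a given completely prime carrier. -/
def toTwoSidedIdeal (hP : IsCompletelyPrimeSet P) : TwoSidedIdeal A :=
  TwoSidedIdeal.mk' P hP.zero_mem hP.add_mem hP.neg_mem (hP.mul_left _) (hP.mul_right _)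

theorem mem_toTwoSidedIdeal (hP : IsCompletelyPrimeSet P) {x : A} :
    x ∈ hP.toTwoSidedIdeal ↔ x ∈ P :=
  TwoSidedIdeal.mem_mk' _ _ _ _ _ _ _

theorem isPrimeIdeal (hP : IsCompletelyPrimeSet P) : hP.toTwoSidedIdeal.IsPrimeIdeal := by
  refine ⟨fun h => hP.one_notMem ?_, fun a b hab => ?_⟩
  · rw [← hP.mem_toTwoSidedIdeal, h]
    trivial
  · simp only [mem_toTwoSidedIdeal] at hab ⊢
    have := hab 1
    rw [mul_one] at this
    exact hP.mem_or_mem this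

/-- Incomparable completely prime ideals of a right distributive ring are comaximal. -/
theorem exists_mem_one_sub_mem (hdist : IsRightDistributive A) (hP : IsCompletelyPrimeSet P)
    (hQ : IsCompletelyPrimeSet Q) (hPQ : ¬P ⊆ Q) (hQP : ¬Q ⊆ P) :
    ∃ t ∈ Q, 1 - t ∈ P := by
  obtain ⟨a, haP, haQ⟩ := Set.not_subset.1 hPQ
  obtain ⟨b, hbQ, hbP⟩ := Set.not_subset.1 hQP
  obtain ⟨t, ⟨c, hc⟩, d, hd⟩ := hdist.exists_mul_eq_s18 a b
  refine ⟨t, ?_, ?_⟩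
  · exact (hQ.mem_or_mem (hc ▸ hQ.mul_right c hbQ)).resolve_left haQ
  · exact (hP.mem_or_mem (hd ▸ hP.mul_right d haP)).resolve_left hbP

/-- A nilpotent completely prime ideal is the prime radical. -/
theorem mem_primeRadical_iff (hP : IsCompletelyPrimeSet P) {k : ℕ}
    (hk : ∀ l : List A, l.length = k → (∀ a ∈ l, a ∈ P) → l.prod = 0) {x : A} :
    x ∈ primeRadical A ↔ x ∈ P := by
  unfold primeRadical
  rw [TwoSidedIdeal.mem_sInf]
  constructor
  · intro h
    exact hP.mem_toTwoSidedIdeal.1 (h _ hP.isPrimeIdeal)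
  · intro hx Q hQ
    by_contra hxQ
    have key : ∀ m : ℕ, ∃ l : List A, l.length = m ∧ (∀ a ∈ l, a ∈ P) ∧ l.prod ∉ Q := by
      intro m
      induction m with
      | zero =>
        refine ⟨[], rfl, by simp, fun h => hQ.1 ?_⟩
        rw [List.prod_nil] at h
        exact TwoSidedIdeal.one_mem_iff _ |>.1 h
      | succ m ih =>
        obtain ⟨l, hl, hlP, hlQ⟩ := ih
        have h : ¬∀ y, x * y * l.prod ∈ Q := fun h => (hQ.2 _ _ h).elim hxQ hlQ
        push Not at h
        obtain ⟨y, hy⟩ := h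
        refine ⟨(x * y) :: l, by simp [hl], ?_, by simpa using hy⟩
        intro a ha
        rcases List.mem_cons.1 ha with rfl | ha
        · exact hP.mul_right _ hx
        · exact hlP a ha
    obtain ⟨l, hl, hlP, hlQ⟩ := key k
    exact hlQ (hk l hl hlP ▸ Q.zero_mem)

end IsCompletelyPrimeSet

/-- In a right distributive ring with no nontrivial central idempotents, a finite nonempty
family of completely prime ideals with nil intersection has a least element. -/
theorem IsRightDistributive.exists_least_completelyPrime (hdist : IsRightDistributive A)
    (hindec : ∀ e : A, e ∈ Set.center A → e * e = e → e = 0 ∨ e = 1)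
    {S : Set (Set A)} (hfin : S.Finite) (hne : S.Nonempty)
    (hS : ∀ P ∈ S, IsCompletelyPrimeSet P)
    (hnil : ∀ x, (∀ P ∈ S, x ∈ P) → ∃ n : ℕ, n ≠ 0 ∧ x ^ n = 0) :
    ∃ Q ∈ S, ∀ P ∈ S, Q ⊆ P := by
  classical
  obtain ⟨Q, hQmin⟩ := hfin.exists_minimal hne
  have hQS := hQmin.prop
  have hQ := hS Q hQS
  refine ⟨Q, hQS, ?_⟩
  by_contra! hex
  obtain ⟨P₀, hP₀S, hP₀⟩ := hex
  have hprod : ∀ T : Set (Set A), T.Finite → T ⊆ S →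
      ∃ f, 1 - f ∈ Q ∧ ∀ P ∈ T, ¬Q ⊆ P → f ∈ P := by
    intro T hT
    induction T, hT using Set.Finite.induction_on with
    | empty => exact fun _ => ⟨1, by simpa using hQ.zero_mem, by simp⟩
    | @insert P T _ _ ih =>
      intro hTS
      obtain ⟨f, hfQ, hf⟩ := ih ((Set.subset_insert _ _).trans hTS)
      have hPS : P ∈ S := hTS (Set.mem_insert _ _)
      have hP := hS P hPS
      by_cases hQP : Q ⊆ P
      · refine ⟨f, hfQ, ?_⟩
        intro P' hP' hQP'
        rcases Set.mem_insert_iff.1 hP' with rfl | h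
        · exact absurd hQP hQP'
        · exact hf _ h hQP'
      · obtain ⟨t, htP, htQ⟩ := hQ.exists_mem_one_sub_mem hdist hP hQP
          (fun h => hQP (hQmin.le_of_le hPS h))
        refine ⟨t * f, ?_, ?_⟩
        · have : 1 - t * f = (1 - t) * f + (1 - f) := by noncomm_ring
          rw [this]
          exact hQ.add_mem (hQ.mul_right _ htQ) hfQ
        · intro P' hP' hQP'
          rcases Set.mem_insert_iff.1 hP' with rfl | h
          · exact hP.mul_right _ htP
          · exact (hS P' (hTS hP')).mul_left _ (hf _ h hQP')
  obtain ⟨f, hfQ, hf⟩ := hprod S hfin subset_rfl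
  obtain ⟨n, hn, hpow⟩ := hnil (f - f ^ 2) (by
    intro P hP
    have h : f - f ^ 2 = f * (1 - f) := by noncomm_ring
    rw [h]
    by_cases hQP : Q ⊆ P
    · exact (hS P hP).mul_left _ (hQP hfQ)
    · exact (hS P hP).mul_right _ (hf P hP hQP))
  have hidem := isIdempotentElem_one_sub_one_sub_pow_pow f n hpow
  have h0 := hS P₀ hP₀S
  have hmem₀ : 1 - (1 - f ^ n) ^ n ∈ P₀ :=
    h0.one_sub_one_sub_pow_mem (h0.pow_mem (hf _ hP₀S hP₀) hn) n
  have hmemQ : (1 - f ^ n) ^ n ∈ Q := by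
    refine hQ.pow_mem ?_ hn
    have := hQ.one_sub_one_sub_pow_mem hfQ n
    rwa [sub_sub_cancel] at this
  rcases hindec _ (hdist.mem_center_of_isIdempotentElem hidem) hidem with h | h
  · rw [sub_eq_zero] at h
    exact hQ.one_notMem (h ▸ hmemQ)
  · exact h0.one_notMem (h ▸ hmem₀)

end CompletelyPrime

section Annihilators

variable {A : Type*} [Ring A]

theorem wellFounded_gt_isRightAnnihilator
    (hacc : ¬∃ f : ℕ → Set A, (∀ k, IsRightAnnihilator (f k)) ∧ StrictMono f) :
    WellFoundedGT {T : Set A // IsRightAnnihilator T} := by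
  rw [WellFoundedGT, isWellFounded_iff, RelEmbedding.wellFounded_iff_isEmpty]
  refine ⟨fun f => hacc ⟨fun n => (f n).1, fun n => (f n).2, fun m n hmn => ?_⟩⟩
  exact f.map_rel_iff.2 hmn

/-- The elements annihilating on the left some nonzero element of `U`. -/
def annihilatingSet (U : Submodule Aᵐᵒᵖ A) : Set A :=
  {a : A | ∃ u ∈ U, u ≠ 0 ∧ a * u = 0}

theorem annihilatingSet_mono {U V : Submodule Aᵐᵒᵖ A} (h : U ≤ V) :
    annihilatingSet U ⊆ annihilatingSet V := by
  rintro a ⟨u, hu, hu0, hau⟩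
  exact ⟨u, h hu, hu0, hau⟩

theorem IsUniformRightIdeal.exists_mul_eq_s18 {U : Submodule Aᵐᵒᵖ A} (hU : IsUniformRightIdeal U)
    {x y : A} (hx : x ∈ U) (hy : y ∈ U) (hx0 : x ≠ 0) (hy0 : y ≠ 0) :
    ∃ c d, x * c = y * d ∧ x * c ≠ 0 := by
  have h := hU.2 (Submodule.span Aᵐᵒᵖ {x}) (Submodule.span Aᵐᵒᵖ {y})
    (by simpa using hx) (by simpa using hy) (by simpa using hx0) (by simpa using hy0)
  rw [Submodule.disjoint_def] at h
  push Not at h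
  obtain ⟨z, hzx, hzy, hz⟩ := h
  obtain ⟨c, rfl⟩ := mem_span_singleton_mulOpposite.1 hzx
  obtain ⟨d, hd⟩ := mem_span_singleton_mulOpposite.1 hzy
  exact ⟨c, d, hd.symm, hz⟩

theorem IsUniformRightIdeal.annihilatingSet_subset {U V : Submodule Aᵐᵒᵖ A}
    (hU : IsUniformRightIdeal U) (hUV : ¬Disjoint U V) :
    annihilatingSet U ⊆ annihilatingSet V := by
  rintro a ⟨u, hu, hu0, hau⟩
  rw [Submodule.disjoint_def] at hUV
  push Not at hUV
  obtain ⟨z, hzU, hzV, hz⟩ := hUV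
  obtain ⟨c, d, hcd, h0⟩ := hU.exists_mul_eq_s18 hzU hu hz hu0
  refine ⟨z * c, mul_mem_rightIdeal hzV c, h0, ?_⟩
  rw [hcd, ← mul_assoc, hau, zero_mul]

theorem IsUniformRightIdeal.isCompletelyPrimeSet (hdist : IsRightDistributive A)
    {U : Submodule Aᵐᵒᵖ A} (hU : IsUniformRightIdeal U) :
    IsCompletelyPrimeSet (annihilatingSet U) where
  zero_mem := by
    obtain ⟨u, hu, hu0⟩ := Submodule.exists_mem_ne_zero_of_ne_bot hU.1
    exact ⟨u, hu, hu0, zero_mul u⟩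
  add_mem := by
    rintro x y ⟨u, hu, hu0, hxu⟩ ⟨v, hv, hv0, hyv⟩
    obtain ⟨c, d, hcd, h0⟩ := hU.exists_mul_eq_s18 hu hv hu0 hv0
    refine ⟨u * c, mul_mem_rightIdeal hu c, h0, ?_⟩
    rw [add_mul, ← mul_assoc, hxu, hcd, ← mul_assoc, hyv, zero_mul, zero_mul, add_zero]
  mul_left := by
    rintro x y ⟨u, hu, hu0, hyu⟩
    exact ⟨u, hu, hu0, by rw [mul_assoc, hyu, mul_zero]⟩
  mul_right := by
    rintro x y ⟨u, hu, hu0, hxu⟩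
    by_cases hyu : y * u = 0
    · exact ⟨u, hu, hu0, by rw [mul_assoc, hyu, mul_zero]⟩
    · obtain ⟨c, d, hcd, h0⟩ := hdist.exists_common_multiple hyu
      refine ⟨u * d, mul_mem_rightIdeal hu d, fun h => h0 ?_, ?_⟩
      · rw [hcd, mul_assoc, h, mul_zero]
      · rw [mul_assoc x, ← mul_assoc y, ← hcd, ← mul_assoc, hxu, zero_mul]
  one_notMem := by
    rintro ⟨u, hu, hu0, h⟩
    exact hu0 (by rwa [one_mul] at h)
  mem_or_mem := by
    rintro x y ⟨u, hu, hu0, hxyu⟩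
    by_cases hyu : y * u = 0
    · exact Or.inr ⟨u, hu, hu0, hyu⟩
    · obtain ⟨c, d, hcd, h0⟩ := hdist.exists_common_multiple hyu
      refine Or.inl ⟨u * c, mul_mem_rightIdeal hu c, h0, ?_⟩
      rw [hcd, ← mul_assoc, ← mul_assoc, hxyu, zero_mul]

theorem IsRightDistributive.finite_annihilatingSet (hdist : IsRightDistributive A)
    (hnosum : ¬∃ f : ℕ → Submodule Aᵐᵒᵖ A, (∀ k, f k ≠ ⊥) ∧ iSupIndep f) :
    (annihilatingSet '' {U : Submodule Aᵐᵒᵖ A | IsUniformRightIdeal U}).Finite := by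
  by_contra hinf
  let g := Set.Infinite.natEmbedding _ hinf
  choose U hU hUg using fun n => (g n).2
  refine hnosum ⟨U, fun n => (hU n).1, hdist.iSupIndep_of_pairwise_disjoint fun i j hij => ?_⟩
  by_contra hd
  refine hij (g.injective (Subtype.ext ?_))
  rw [← hUg i, ← hUg j]
  exact subset_antisymm ((hU i).annihilatingSet_subset hd)
    ((hU j).annihilatingSet_subset fun h => hd h.symm)

/-- With the maximum condition on right annihilators, a set closed under left multiplication
all of whose elements annihilate something in every nonzero right ideal is nilpotent. -/
theorem exists_prod_eq_zero_of_singular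
    (hacc : ¬∃ f : ℕ → Set A, (∀ k, IsRightAnnihilator (f k)) ∧ StrictMono f)
    {Z : Set A} (hmul : ∀ x, ∀ y ∈ Z, x * y ∈ Z)
    (hZ : ∀ z ∈ Z, ∀ I : Submodule Aᵐᵒᵖ A, I ≠ ⊥ → z ∈ annihilatingSet I) :
    ∃ k : ℕ, k ≠ 0 ∧ ∀ l : List A, l.length = k → (∀ a ∈ l, a ∈ Z) → l.prod = 0 := by
  have := wellFounded_gt_isRightAnnihilator hacc
  let R : ℕ → Set A := fun n =>
    {a | ∀ s ∈ {p : A | ∃ l : List A, l.length = n ∧ (∀ a ∈ l, a ∈ Z) ∧ l.prod = p}, s * a = 0}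
  have hR : ∀ n, IsRightAnnihilator (R n) := fun n => ⟨_, rfl⟩
  have hmono : Monotone fun n => (⟨R n, hR n⟩ : {T : Set A // IsRightAnnihilator T}) := by
    refine monotone_nat_of_le_succ fun n => ?_
    rintro a ha s ⟨l, hl, hlZ, rfl⟩
    obtain ⟨z, l, rfl⟩ := List.exists_cons_of_length_eq_add_one hl
    rw [List.prod_cons, mul_assoc, ha _ ⟨l, by simpa using hl,
      fun a ha => hlZ a (List.mem_cons_of_mem _ ha), rfl⟩, mul_zero]
  obtain ⟨n, hn⟩ := WellFoundedGT.monotone_chain_condition ⟨_, hmono⟩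
  have hstab : R n = R (n + 1) := congrArg Subtype.val (hn (n + 1) n.le_succ)
  refine ⟨n + 1, n.succ_ne_zero, ?_⟩
  by_contra! hex
  have hbad : {T : {T : Set A // IsRightAnnihilator T} |
      ∃ a ∈ Z, a ∉ R n ∧ T.1 = {x | ∀ s ∈ ({a} : Set A), s * x = 0}}.Nonempty := by
    obtain ⟨l, hl, hlZ, hl0⟩ := hex
    have hne : l ≠ [] := by
      rintro rfl
      simp at hl
    refine ⟨⟨_, {l.getLast hne}, rfl⟩, l.getLast hne, hlZ _ (List.getLast_mem hne), fun h => ?_,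
      rfl⟩
    have h1 := h l.dropLast.prod ⟨l.dropLast, by simp [hl],
      fun a ha => hlZ a (List.mem_of_mem_dropLast ha), rfl⟩
    apply hl0
    rw [← List.dropLast_append_getLast hne, List.prod_append, List.prod_singleton]
    exact h1
  obtain ⟨T, ⟨a, haZ, haR, hT⟩, hmax⟩ := WellFounded.has_min this.wf _ hbad
  apply haR
  rw [hstab]
  rintro s ⟨l, hl, hlZ, rfl⟩
  have hne : l ≠ [] := by
    rintro rfl
    simp at hl
  rw [← List.dropLast_append_getLast hne, List.prod_append, List.prod_singleton, mul_assoc]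
  set b := l.getLast hne
  have hbZ : b ∈ Z := hlZ _ (List.getLast_mem hne)
  have hbR : b * a ∈ R n := by
    by_contra hbR
    refine hmax ⟨_, {b * a}, rfl⟩ ⟨b * a, hmul _ _ haZ, hbR, rfl⟩ ?_
    have ha0 : a ≠ 0 := by
      rintro rfl
      exact haR fun s _ => mul_zero s
    obtain ⟨u, hu, hu0, hbu⟩ := hZ b hbZ (Submodule.span Aᵐᵒᵖ {a}) (by simpa using ha0)
    obtain ⟨c, rfl⟩ := mem_span_singleton_mulOpposite.1 hu
    change T.1 < _
    rw [hT]
    refine (Set.ssubset_iff_of_subset ?_).2 ⟨c, ?_, ?_⟩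
    · intro x hx
      simp only [Set.mem_singleton_iff, forall_eq, Set.mem_ofPred_eq] at hx ⊢
      rw [mul_assoc, hx, mul_zero]
    · simpa [mul_assoc] using hbu
    · simpa using hu0
  exact hbR _ ⟨l.dropLast, by simp [hl], fun a ha => hlZ a (List.mem_of_mem_dropLast ha), rfl⟩

/-- With the maximum condition on right annihilators, left multiplication by `a` is injective
on any set on which all powers of `a` act surjectively. -/
theorem eq_zero_of_mul_eq_zero_of_pow_surjOn
    (hacc : ¬∃ f : ℕ → Set A, (∀ k, IsRightAnnihilator (f k)) ∧ StrictMono f)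
    {B : Set A} {a u : A} (hB : ∀ n : ℕ, ∀ x ∈ B, ∃ y ∈ B, x = a ^ n * y) (hu : u ∈ B)
    (hau : a * u = 0) : u = 0 := by
  have := wellFounded_gt_isRightAnnihilator hacc
  let R : ℕ → Set A := fun n => {x | ∀ s ∈ ({a ^ n} : Set A), s * x = 0}
  have hR : ∀ n, IsRightAnnihilator (R n) := fun n => ⟨_, rfl⟩
  have hmono : Monotone fun n => (⟨R n, hR n⟩ : {T : Set A // IsRightAnnihilator T}) := by
    refine monotone_nat_of_le_succ fun n => ?_
    rintro x hx s rfl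
    rw [pow_succ', mul_assoc, hx _ rfl, mul_zero]
  obtain ⟨n, hn⟩ := WellFoundedGT.monotone_chain_condition ⟨_, hmono⟩
  have hstab : R n = R (n + 1) := congrArg Subtype.val (hn (n + 1) n.le_succ)
  obtain ⟨v, -, rfl⟩ := hB n u hu
  have hv : v ∈ R (n + 1) := by
    rintro s rfl
    rw [pow_succ', mul_assoc, hau]
  rw [← hstab] at hv
  exact hv _ rfl

/-- In a right distributive ring, a nil completely prime ideal `P` satisfies `P = aP` for
every `a ∉ P`. -/
theorem IsCompletelyPrimeSet.exists_eq_mul (hdist : IsRightDistributive A) {P : Set A}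
    (hP : IsCompletelyPrimeSet P) (hnil : ∀ x ∈ P, IsNilpotent x) {a b : A} (ha : a ∉ P)
    (hb : b ∈ P) : ∃ c ∈ P, b = a * c := by
  obtain ⟨t, ⟨c, hc⟩, d, hd⟩ := hdist.exists_mul_eq_s18 a b
  have ht : t ∈ P := (hP.mem_or_mem (hc ▸ hP.mul_right c hb)).resolve_left ha
  obtain ⟨v, hv⟩ := (hnil t ht).isUnit_one_sub.exists_right_inv
  have hbd : b = a * (d * v) := by
    rw [← mul_assoc, hd, mul_assoc, hv, mul_one]
  exact ⟨d * v, (hP.mem_or_mem (hbd ▸ hb)).resolve_left ha, hbd⟩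

end Annihilators

/-- Let `A` be a right distributive indecomposable ring satisfying the maximum condition
on right annihilators and containing no infinite direct sum of nonzero right ideals, and
suppose `A` is not a right uniform domain.  Then the prime radical `B` of `A` is a
nonzero, completely prime, nilpotent ideal, `B` equals the set of all left zero-divisors
of `A`, `B` is an essential right ideal of `A`, and `B = aB` for every `a ∈ A \ B`. -/
theorem primeRadical_of_rightDistributive_indecomposable {A : Type*} [Ring A]
    [Nontrivial A]
    (hdist : IsRightDistributive A)
    (hindec : ∀ e : A, e ∈ Set.center A → e * e = e → e = 0 ∨ e = 1)
    (hacc : ¬∃ f : ℕ → Set A, (∀ k, IsRightAnnihilator (f k)) ∧ StrictMono f)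
    (hnosum : ¬∃ f : ℕ → Submodule Aᵐᵒᵖ A, (∀ k, f k ≠ ⊥) ∧ iSupIndep f)
    (hnotud : ¬((∀ x y : A, x * y = 0 → x = 0 ∨ y = 0) ∧
      ∀ I J : Submodule Aᵐᵒᵖ A, I ≠ ⊥ → J ≠ ⊥ → I ⊓ J ≠ ⊥)) :
    primeRadical A ≠ ⊥ ∧
      (∀ a a' : A, a ∉ primeRadical A → a' ∉ primeRadical A → a * a' ∉ primeRadical A) ∧
      (∃ k : ℕ, ∀ l : List A, l.length = k → (∀ a ∈ l, a ∈ primeRadical A) →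
        l.prod = 0) ∧
      ((primeRadical A : Set A) = leftZeroDivisors A) ∧
      (∀ I : Submodule Aᵐᵒᵖ A, I ≠ ⊥ → ∃ x : A, x ≠ 0 ∧ x ∈ I ∧ x ∈ primeRadical A) ∧
      (∀ a : A, a ∉ primeRadical A →
        (primeRadical A : Set A) = (fun x => a * x) '' (primeRadical A : Set A)) := by
  have hex : ∀ I : Submodule Aᵐᵒᵖ A, I ≠ ⊥ → ∃ U ≤ I, IsUniformRightIdeal U :=
    fun I hI => hdist.exists_isUniformRightIdeal_le hnosum hI
  have hcp : ∀ P ∈ annihilatingSet '' {U : Submodule Aᵐᵒᵖ A | IsUniformRightIdeal U},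
      IsCompletelyPrimeSet P := by
    rintro _ ⟨U, hU, rfl⟩
    exact IsUniformRightIdeal.isCompletelyPrimeSet hdist hU
  obtain ⟨k, hk0, hk⟩ := exists_prod_eq_zero_of_singular hacc
    (Z := {x | ∀ P ∈ annihilatingSet '' {U : Submodule Aᵐᵒᵖ A | IsUniformRightIdeal U}, x ∈ P})
    (fun x y hy P hP => (hcp P hP).mul_left x (hy P hP))
    (fun z hz I hI => by
      obtain ⟨U, hUI, hU⟩ := hex I hI
      exact annihilatingSet_mono hUI (hz _ ⟨U, hU, rfl⟩))
  obtain ⟨_, ⟨U₀, hU₀, rfl⟩, hleast⟩ := hdist.exists_least_completelyPrime hindec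
    (hdist.finite_annihilatingSet hnosum)
    (by
      obtain ⟨U, -, hU⟩ := hex ⊤ top_ne_bot
      exact ⟨_, U, hU, rfl⟩) hcp
    (fun x hx => ⟨k, hk0, by
      rw [← List.prod_replicate]
      refine hk _ (by simp) fun a ha => ?_
      rw [List.eq_of_mem_replicate ha]
      exact hx⟩)
  have hP := IsUniformRightIdeal.isCompletelyPrimeSet hdist hU₀
  have hkP : ∀ l : List A, l.length = k → (∀ a ∈ l, a ∈ annihilatingSet U₀) → l.prod = 0 :=
    fun l hl hlP => hk l hl fun a ha P hPS => hleast P hPS (hlP a ha)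
  have hB : ∀ {x : A}, x ∈ primeRadical A ↔ x ∈ annihilatingSet U₀ :=
    fun {x} => hP.mem_primeRadical_iff hkP
  have hnil : ∀ x ∈ annihilatingSet U₀, IsNilpotent x := fun x hx => ⟨k, by
    rw [← List.prod_replicate]
    refine hkP _ (by simp) fun a ha => ?_
    rwa [List.eq_of_mem_replicate ha]⟩
  have hinj : ∀ a u : A, a ∉ annihilatingSet U₀ → u ∈ annihilatingSet U₀ → a * u = 0 → u = 0 :=
    fun a u ha hu hau => eq_zero_of_mul_eq_zero_of_pow_surjOn hacc
      (fun n x hx => hP.exists_eq_mul hdist hnil (hP.pow_notMem ha n) hx) hu hau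
  have hzd : ∀ a x : A, x ≠ 0 → a * x = 0 → a ∈ annihilatingSet U₀ := by
    intro a x hx hax
    obtain ⟨U, hUx, hU⟩ := hex (Submodule.span Aᵐᵒᵖ {x}) (by simpa using hx)
    have haU : ∀ u ∈ U, a * u = 0 := by
      intro u hu
      obtain ⟨c, rfl⟩ := mem_span_singleton_mulOpposite.1 (hUx hu)
      rw [← mul_assoc, hax, zero_mul]
    obtain ⟨u, hu, hu0⟩ := Submodule.exists_mem_ne_zero_of_ne_bot hU.1
    by_cases hd : Disjoint U U₀
    · by_contra ha
      obtain ⟨u', hu', hu0'⟩ := Submodule.exists_mem_ne_zero_of_ne_bot hU₀.1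
      exact hu0 (hinj a u ha
        ⟨u', hu', hu0', hdist.mul_eq_zero_of_disjoint hd hu hu'⟩ (haU u hu))
    · exact hU.annihilatingSet_subset hd ⟨u, hu, hu0, haU u hu⟩
  have hne : ∃ b ∈ annihilatingSet U₀, b ≠ 0 := by
    by_contra! h0
    refine hnotud ⟨fun x y hxy => ?_, fun I J hI hJ hIJ => ?_⟩
    · by_contra! h
      exact h.1 (h0 x (hzd x y h.2 hxy))
    · obtain ⟨x, hx, hx0⟩ := Submodule.exists_mem_ne_zero_of_ne_bot hI
      obtain ⟨y, hy, hy0⟩ := Submodule.exists_mem_ne_zero_of_ne_bot hJ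
      exact hx0 (h0 x (hzd x y hy0
        (hdist.mul_eq_zero_of_disjoint (disjoint_iff.2 hIJ) hx hy)))
  obtain ⟨b, hb, hb0⟩ := hne
  refine ⟨fun h => hb0 ?_, fun a a' ha ha' h => ?_, ⟨k, fun l hl hlB => ?_⟩, ?_, ?_, ?_⟩
  · have := hB.2 hb
    rw [h] at this
    exact (TwoSidedIdeal.mem_bot A).1 this
  · rw [hB] at ha ha' h
    exact (hP.mem_or_mem h).elim ha ha'
  · exact hkP l hl fun a ha => hB.1 (hlB a ha)
  · ext x
    rw [SetLike.mem_coe, hB]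
    constructor
    · rintro ⟨u, -, hu0, hxu⟩
      exact ⟨u, hu0, hxu⟩
    · rintro ⟨y, hy, hxy⟩
      exact hzd x y hy hxy
  · intro I hI
    obtain ⟨i, hi, hi0⟩ := Submodule.exists_mem_ne_zero_of_ne_bot hI
    by_cases hib : i * b = 0
    · exact ⟨i, hi0, hi, hB.2 (hzd i b hb0 hib)⟩
    · exact ⟨i * b, hib, mul_mem_rightIdeal hi b, hB.2 (hP.mul_left i hb)⟩
  · intro a ha
    rw [hB] at ha
    ext x
    simp only [SetLike.mem_coe, Set.mem_image, hB]
    constructor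
    · intro hx
      obtain ⟨c, hc, rfl⟩ := hP.exists_eq_mul hdist hnil ha hx
      exact ⟨c, hc, rfl⟩
    · rintro ⟨c, hc, rfl⟩
      exact hP.mul_left a hc
end
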